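/- Fix an integer n ≥ 1. For y > 0 and an integer k ≥ 0, let w_k(y) denote the k-th approximant of the continued fraction with partial numerators a₁ = 1 and a_j = ((j−1)·n)² for j ≥ 2, and partial denominators b_j = y − (2j−1)·n; explicitly, w_0 = 0 and w_k(y) = 1/(y−n − n²/(y−3n − (2n)²/(⋯ − ((k−1)n)²/(y−(2k−1)n)))). Then for every integer k ≥ 0, e^{−y/n}·∑_{m=n}^∞ (1/m)·π(e^{y/m}) − w_k(y) ∼ (n^k·k!)²/y^{2k+1} as y → ∞. -/

import Mathlib

open Filter

/-- The prime counting function `π(x)`: the number of primes `p ≤ x`. -/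
noncomputable def primePi (x : ℝ) : ℝ := Nat.primeCounting ⌊x⌋₊

/-- `cfApprox a b j k` is the `k`-th approximant of the continued fraction
`a_j/(b_j − a_{j+1}/(b_{j+1} − ⋯))`; the `0`-th approximant is `0`. -/
noncomputable def cfApprox (a b : ℕ → ℝ) : ℕ → ℕ → ℝ
  | _, 0 => 0
  | j, k + 1 => a j / (b j - cfApprox a b (j + 1) k)

section ContinuedFraction

open Topology Asymptotics Finset

/-- If `τ j` are tails of a continued fraction with `τ j y ∼ a (j + 1) / y`, then the
approximants of the continued fraction approximate the tails to the expected order. -/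
theorem tendsto_tail_sub_cfApprox (a : ℕ → ℝ) (b τ : ℕ → ℝ → ℝ)
    (hb : ∀ j, Tendsto (fun y => b (j + 1) y / y) atTop (𝓝 1))
    (hτ : ∀ j, Tendsto (fun y => τ j y * y) atTop (𝓝 (a (j + 1))))
    (hrec : ∀ j, ∀ᶠ y in atTop, τ j y = a (j + 1) / (b (j + 1) y - τ (j + 1) y)) (k : ℕ) :
    ∀ j, Tendsto (fun y => (τ j y - cfApprox a (fun i => b i y) (j + 1) k) * y ^ (2 * k + 1))
      atTop (𝓝 (∏ i ∈ range (k + 1), a (j + 1 + i))) := by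
  have hzero : ∀ (f : ℝ → ℝ) (m : ℕ) (c : ℝ),
      Tendsto (fun y => f y * y ^ (m + 1)) atTop (𝓝 c) → Tendsto f atTop (𝓝 0) := by
    intro f m c hf
    have h1 : Tendsto (fun y : ℝ => (y ^ (m + 1))⁻¹) atTop (𝓝 0) :=
      (tendsto_pow_atTop (Nat.succ_ne_zero m)).inv_tendsto_atTop
    have h2 := hf.mul h1
    rw [mul_zero] at h2
    refine h2.congr' ?_
    filter_upwards [eventually_gt_atTop 0] with y hy
    field_simp
  have hdiv : ∀ (j : ℕ) (f : ℝ → ℝ), Tendsto f atTop (𝓝 0) →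
      Tendsto (fun y => (b (j + 1) y - f y) / y) atTop (𝓝 1) := by
    intro j f hf
    have h2 := (hb j).sub (hf.mul tendsto_inv_atTop_zero)
    rw [mul_zero, sub_zero] at h2
    refine h2.congr fun y => ?_
    rw [sub_div, div_eq_mul_inv (f y)]
  induction k with
  | zero =>
    intro j
    simpa [cfApprox] using hτ j
  | succ k ih =>
    intro j
    have hτ0 : Tendsto (τ (j + 1)) atTop (𝓝 0) :=
      hzero _ 0 _ (by simpa using hτ (j + 1))
    have hd0 := hzero _ _ _ (ih (j + 1))
    have hc0 : Tendsto (fun y => cfApprox a (fun i => b i y) (j + 1 + 1) k) atTop (𝓝 0) := by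
      have := hτ0.sub hd0
      rw [sub_zero] at this
      exact this.congr fun y => by ring
    have h1 := hdiv j _ hτ0
    have h2 := hdiv j _ hc0
    have h3 := ((ih (j + 1)).const_mul (a (j + 1))).div (h1.mul h2) (by norm_num)
    have hprod : a (j + 1) * (∏ i ∈ range (k + 1), a (j + 1 + 1 + i)) / (1 * 1)
        = ∏ i ∈ range (k + 1 + 1), a (j + 1 + i) := by
      rw [prod_range_succ' _ (k + 1), mul_comm]
      simp only [mul_one, div_one, add_zero]
      congr 1
      exact prod_congr rfl fun i _ => by rw [add_assoc (j + 1), add_comm 1 i]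
    rw [hprod] at h3
    refine h3.congr' ?_
    filter_upwards [hrec j, h1.eventually_ne one_ne_zero, h2.eventually_ne one_ne_zero,
      eventually_gt_atTop 0] with y hy hy1 hy2 hy0
    have e1 : b (j + 1) y - τ (j + 1) y ≠ 0 := fun h => hy1 (by rw [h, zero_div])
    have e2 : b (j + 1) y - cfApprox a (fun i => b i y) (j + 1 + 1) k ≠ 0 :=
      fun h => hy2 (by rw [h, zero_div])
    simp only [Pi.div_apply]
    rw [hy, cfApprox]
    field_simp
    ring

/-- The sequence of remainders obtained from `E` by the three-term recurrence
`r (k + 2) = b (k + 1) r (k + 1) - a (k + 1) r k` of the continued fraction. -/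
noncomputable def cfRemainder (a : ℕ → ℝ) (b : ℕ → ℝ → ℝ) (E : ℝ → ℝ) : ℕ → ℝ → ℝ
  | 0 => fun _ => 1
  | 1 => E
  | k + 2 => fun y => b (k + 1) y * cfRemainder a b E (k + 1) y
      - a (k + 1) * cfRemainder a b E k y

/-- The asymptotic coefficients of the remainders. -/
noncomputable def remainderCoeff (c : ℝ) (k j : ℕ) : ℝ :=
  c ^ (j + k) * j.factorial * j.descFactorial k

theorem remainderCoeff_recurrence (c : ℝ) (k j : ℕ) :
    remainderCoeff c (k + 2) j = remainderCoeff c (k + 1) (j + 1)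
      - (2 * k + 3) * c * remainderCoeff c (k + 1) j
      - ((k + 1) * c) ^ 2 * remainderCoeff c k j := by
  simp only [remainderCoeff, Nat.factorial_succ, Nat.succ_descFactorial_succ]
  rcases lt_or_ge j k with h | h
  · simp [Nat.descFactorial_of_lt h]
  obtain ⟨d, rfl⟩ := Nat.exists_eq_add_of_le h
  have h1 : (k + d).descFactorial (k + 1) = d * (k + d).descFactorial k := by
    rw [Nat.descFactorial_succ]; congr 1; omega
  have h2 : (((k + d).descFactorial (k + 2) : ℕ) : ℝ)
      = (d - 1) * d * (k + d).descFactorial k := by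
    rw [Nat.descFactorial_succ, h1]
    rcases Nat.eq_zero_or_pos d with rfl | hd
    · simp
    · rw [show k + d - (k + 1) = d - 1 by omega]
      push_cast [Nat.cast_sub hd]
      ring
  rw [h2, h1]
  push_cast
  ring

theorem remainderCoeff_one (c : ℝ) (j : ℕ) :
    remainderCoeff c 1 j = remainderCoeff c 0 (j + 1) - c * remainderCoeff c 0 j := by
  simp only [remainderCoeff, Nat.factorial_succ, Nat.descFactorial_one, Nat.descFactorial_zero]
  push_cast
  ring

/-- `f` has the asymptotic expansion `∑ e j / y ^ (j + 1)` at infinity. -/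
def HasInvExpansion (f : ℝ → ℝ) (e : ℕ → ℝ) : Prop :=
  ∀ N : ℕ, (fun y => f y - ∑ j ∈ range N, e j / y ^ (j + 1)) =O[atTop]
    fun y : ℝ => 1 / y ^ (N + 1)

theorem HasInvExpansion.const_mul {f : ℝ → ℝ} {e : ℕ → ℝ} (h : HasInvExpansion f e) (c : ℝ) :
    HasInvExpansion (fun y => c * f y) (fun j => c * e j) := by
  intro N
  refine ((h N).const_mul_left c).congr_left fun y => ?_
  rw [mul_sub, mul_sum]
  simp only [mul_div_assoc]

theorem HasInvExpansion.sub {f g : ℝ → ℝ} {e e' : ℕ → ℝ} (h : HasInvExpansion f e)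
    (h' : HasInvExpansion g e') : HasInvExpansion (fun y => f y - g y) (fun j => e j - e' j) := by
  intro N
  refine ((h N).sub (h' N)).congr_left fun y => ?_
  simp only [sub_div, sum_sub_distrib]
  ring

theorem HasInvExpansion.mul_self {f : ℝ → ℝ} {e : ℕ → ℝ} (h : HasInvExpansion f e) :
    HasInvExpansion (fun y => y * f y - e 0) (fun j => e (j + 1)) := by
  intro N
  have h1 := (isBigO_refl (fun y : ℝ => y) atTop).mul (h (N + 1))
  refine h1.congr' ?_ ?_
  · filter_upwards [eventually_gt_atTop 0] with y hy
    rw [sum_range_succ', mul_sub, mul_add, mul_sum]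
    have : y * (e 0 / y ^ (0 + 1)) = e 0 := by field_simp; ring
    rw [this]
    have : ∀ j, y * (e (j + 1) / y ^ (j + 1 + 1)) = e (j + 1) / y ^ (j + 1) := by
      intro j; field_simp; ring
    simp only [this]
    ring
  · filter_upwards [eventually_gt_atTop 0] with y hy
    field_simp
    ring

theorem HasInvExpansion.tendsto {f : ℝ → ℝ} {e : ℕ → ℝ} (h : HasInvExpansion f e) {k : ℕ}
    (hk : ∀ j < k, e j = 0) : Tendsto (fun y => f y * y ^ (k + 1)) atTop (𝓝 (e k)) := by
  have h1 := (isBigO_refl (fun y : ℝ => y ^ (k + 1)) atTop).mul (h (k + 1))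
  have h2 : Tendsto (fun y : ℝ => y ^ (k + 1) * (f y - ∑ j ∈ range (k + 1), e j / y ^ (j + 1)))
      atTop (𝓝 0) := by
    refine h1.trans_tendsto ?_
    refine tendsto_inv_atTop_zero.congr' ?_
    filter_upwards [eventually_gt_atTop 0] with y hy
    field_simp
    ring
  have h3 := h2.add_const (e k)
  rw [zero_add] at h3
  refine h3.congr' ?_
  filter_upwards [eventually_gt_atTop 0] with y hy
  rw [sum_range_succ, sum_eq_zero fun j hj => by rw [hk j (mem_range.1 hj), zero_div]]
  field_simp
  ring

theorem remainderCoeff_of_lt {c : ℝ} {k j : ℕ} (h : j < k) : remainderCoeff c k j = 0 := by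
  simp [remainderCoeff, Nat.descFactorial_of_lt h]

theorem hasInvExpansion_cfRemainder {c : ℝ} {E : ℝ → ℝ} {a : ℕ → ℝ} {b : ℕ → ℝ → ℝ}
    (ha1 : a 1 = 1) (ha : ∀ k, a (k + 2) = ((k + 1) * c) ^ 2)
    (hb : ∀ k y, b (k + 1) y = y - (2 * k + 1) * c)
    (hE : HasInvExpansion E fun j => c ^ j * j.factorial) (k : ℕ) :
    HasInvExpansion (cfRemainder a b E (k + 1)) (remainderCoeff c k) := by
  induction k using Nat.twoStepInduction with
  | zero =>
    have : remainderCoeff c 0 = fun j => c ^ j * j.factorial := by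
      ext j; simp [remainderCoeff]
    rw [this]
    exact hE
  | one =>
    have h0 : HasInvExpansion E (remainderCoeff c 0) := by
      convert hE using 2 with j
      simp [remainderCoeff]
    have h := h0.mul_self.sub (h0.const_mul c)
    have e1 : (fun j => remainderCoeff c 0 (j + 1) - c * remainderCoeff c 0 j)
        = remainderCoeff c 1 := by
      ext j; rw [remainderCoeff_one]
    rw [e1] at h
    convert h using 2 with y
    simp only [cfRemainder, zero_add]
    rw [ha1, hb 0 y]
    simp [remainderCoeff]
    ring
  | more k h0 h1 =>
    have h := (h1.mul_self.sub (h1.const_mul ((2 * k + 3) * c))).sub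
      (h0.const_mul (((k + 1) * c) ^ 2))
    have e1 : (fun j => remainderCoeff c (k + 1) (j + 1)
        - (2 * k + 3) * c * remainderCoeff c (k + 1) j
        - ((k + 1) * c) ^ 2 * remainderCoeff c k j) = remainderCoeff c (k + 2) := by
      ext j; rw [remainderCoeff_recurrence]
    rw [e1] at h
    convert h using 2 with y
    simp only [cfRemainder]
    rw [hb (k + 1) y, ha k, remainderCoeff_of_lt (Nat.succ_pos k)]
    push_cast
    ring

/-- The approximants of the continued fraction of an asymptotically factorial series. -/
theorem tendsto_sub_cfApprox {c : ℝ} (hc : 0 < c) {E : ℝ → ℝ} {a : ℕ → ℝ} {b : ℕ → ℝ → ℝ}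
    (ha1 : a 1 = 1) (ha : ∀ k, a (k + 2) = ((k + 1) * c) ^ 2)
    (hb : ∀ k y, b (k + 1) y = y - (2 * k + 1) * c)
    (hE : HasInvExpansion E fun j => c ^ j * j.factorial) (k : ℕ) :
    Tendsto (fun y => (E y - cfApprox a (fun i => b i y) 1 k) * y ^ (2 * k + 1)) atTop
      (𝓝 ((c ^ k * k.factorial) ^ 2)) := by
  set r := cfRemainder a b E with hr
  have hlim : ∀ k, Tendsto (fun y => r (k + 1) y * y ^ (k + 1)) atTop
      (𝓝 (remainderCoeff c k k)) := fun k =>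
    (hasInvExpansion_cfRemainder ha1 ha hb hE k).tendsto fun j hj => remainderCoeff_of_lt hj
  have hcoeff : ∀ k, remainderCoeff c k k = (c ^ k * k.factorial) ^ 2 := fun k => by
    rw [remainderCoeff, Nat.descFactorial_self]; ring
  have hpos : ∀ k, 0 < remainderCoeff c k k := fun k => by
    rw [hcoeff]; positivity
  have hne : ∀ k, ∀ᶠ y in atTop, r k y ≠ 0 := by
    intro k
    rcases k with _ | k
    · exact Eventually.of_forall fun y => one_ne_zero
    · filter_upwards [(hlim k).eventually_ne (hpos k).ne'] with y hy h
      exact hy (by rw [h, zero_mul])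
  have hane : ∀ k, a (k + 1) ≠ 0 := by
    intro k
    rcases k with _ | k
    · rw [ha1]; exact one_ne_zero
    · rw [ha]; positivity
  have key := tendsto_tail_sub_cfApprox a b (fun j y => r (j + 1) y / r j y) ?_ ?_ ?_ k 0
  · have hprod : ∏ i ∈ range (k + 1), a (0 + 1 + i) = (c ^ k * k.factorial) ^ 2 := by
      clear key
      induction k with
      | zero => simp [ha1]
      | succ k ih =>
        rw [prod_range_succ, ih, show 0 + 1 + (k + 1) = k + 2 by omega, ha, Nat.factorial_succ]
        push_cast; ring
    rw [hprod] at key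
    refine key.congr fun y => ?_
    simp [hr, cfRemainder]
  · intro j
    simp only [hb]
    have : Tendsto (fun y : ℝ => 1 - (2 * j + 1) * c * y⁻¹) atTop (𝓝 1) := by
      simpa using (tendsto_inv_atTop_zero.const_mul ((2 * j + 1) * c)).const_sub 1
    refine this.congr' ?_
    filter_upwards [eventually_gt_atTop 0] with y hy
    field_simp
  · intro j
    rcases j with _ | j
    · have := hlim 0
      simp only [hcoeff] at this
      simpa [hr, cfRemainder, ha1] using this
    · have := (hlim (j + 1)).div (hlim j) (hpos j).ne'
      have e : remainderCoeff c (j + 1) (j + 1) / remainderCoeff c j j = a (j + 1 + 1) := by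
        rw [ha, hcoeff, hcoeff, Nat.factorial_succ]
        have := Nat.factorial_pos j
        push_cast
        field_simp
        ring
      rw [e] at this
      refine this.congr' ?_
      filter_upwards [eventually_gt_atTop 0, hne (j + 1)] with y hy h1
      simp only [Pi.div_apply]
      field_simp
      ring
  · intro j
    filter_upwards [hne j, hne (j + 1)] with y h0 h1
    have e : b (j + 1) y - r (j + 1 + 1) y / r (j + 1) y = a (j + 1) * r j y / r (j + 1) y := by
      have : r (j + 1 + 1) y = b (j + 1) y * r (j + 1) y - a (j + 1) * r j y := rfl
      rw [this]
      field_simp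
      ring
    rw [e]
    have := hane j
    field_simp

end ContinuedFraction

section PrimeCountingExpansion

open Topology Asymptotics MeasureTheory Real intervalIntegral

theorem intervalIntegrable_inv_log_pow (m : ℕ) {a b : ℝ} (ha : 1 < a) (hb : 1 < b) :
    IntervalIntegrable (fun t : ℝ => 1 / log t ^ m) volume a b := by
  refine ContinuousOn.intervalIntegrable fun x hx ↦ ContinuousAt.continuousWithinAt ?_
  rw [Set.mem_uIcc] at hx
  have : x ≠ 0 := by grind
  have : log x ^ m ≠ 0 := pow_ne_zero _ (log_ne_zero.mpr (by grind))
  fun_prop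

theorem integral_inv_log_pow_le (m : ℕ) {a b : ℝ} (hab : a ≤ b) (ha : 1 < a) :
    ∫ t in a..b, 1 / log t ^ m ≤ (b - a) / log a ^ m := by
  have hla := log_pos ha
  calc
  _ ≤ ∫ _ in a..b, 1 / log a ^ m := by
      refine integral_mono_on hab ?_ (by simp) fun x ⟨h1, _⟩ ↦ ?_
      · exact intervalIntegrable_inv_log_pow m ha (ha.trans_le hab)
      · gcongr
  _ = _ := by simp [field]

theorem log_pow_isBigO_rpow (m : ℕ) {s : ℝ} (hs : 0 < s) :
    (fun x : ℝ => log x ^ m) =O[atTop] fun x => x ^ s := by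
  have := (isLittleO_log_rpow_rpow_atTop (m : ℝ) hs).isBigO
  simpa [rpow_natCast] using this

theorem sqrt_isBigO_div_log_pow (m : ℕ) :
    (fun x : ℝ => √x) =O[atTop] fun x => x / log x ^ m := by
  have h := (log_pow_isBigO_rpow m (s := 1 / 2) (by norm_num)).mul
    (isBigO_refl (fun x : ℝ => √x / log x ^ m) atTop)
  refine h.congr' ?_ ?_
  · filter_upwards [eventually_gt_atTop 1] with x hx
    have := log_pos hx
    field_simp
  · filter_upwards [eventually_gt_atTop 1] with x hx
    have := log_pos hx
    rw [← sqrt_eq_rpow, ← mul_div_assoc, mul_self_sqrt (by linarith)]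

theorem const_isBigO_div_log_pow (c : ℝ) (m : ℕ) :
    (fun _ : ℝ => c) =O[atTop] fun x => x / log x ^ m := by
  refine IsBigO.trans ?_ (sqrt_isBigO_div_log_pow m)
  refine IsBigO.of_bound |c| ?_
  filter_upwards [eventually_ge_atTop 1] with x hx
  rw [norm_eq_abs, norm_eq_abs, abs_of_nonneg (sqrt_nonneg x)]
  exact le_mul_of_one_le_right (abs_nonneg c) (one_le_sqrt.2 hx)

theorem integral_inv_log_pow_isBigO (m : ℕ) :
    (fun x : ℝ => ∫ t in (2 : ℝ)..x, 1 / log t ^ m) =O[atTop] fun x => x / log x ^ m := by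
  have h : (fun x : ℝ => √x * (1 / log 2 ^ m) + 2 ^ m * (x / log x ^ m)) =O[atTop]
      fun x => x / log x ^ m := by
    refine IsBigO.add ?_ ((isBigO_refl _ _).const_mul_left _)
    exact ((sqrt_isBigO_div_log_pow m).const_mul_left (1 / log 2 ^ m)).congr_left
      fun x => mul_comm _ _
  refine IsBigO.trans (IsBigO.of_bound' ?_) h
  filter_upwards [eventually_ge_atTop 4] with x hx
  have hs2 : 2 ≤ √x := le_sqrt_of_sq_le <| by norm_num [hx]
  have hsx : √x ≤ x := sqrt_le_left (by linarith) |>.mpr (by nlinarith)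
  have hl2 : 0 < log 2 := log_pos (by norm_num)
  have hls : 0 < log √x := log_pos (by linarith)
  have hlx : 0 < log x := log_pos (by linarith)
  have hnonneg : 0 ≤ ∫ t in (2 : ℝ)..x, 1 / log t ^ m :=
    integral_nonneg (by linarith) fun u hu => by
      have := log_pos (show 1 < u by linarith [hu.1])
      positivity
  rw [norm_of_nonneg hnonneg, norm_of_nonneg (by positivity),
    ← integral_add_adjacent_intervals
      (intervalIntegrable_inv_log_pow m (by norm_num) (by linarith))
      (intervalIntegrable_inv_log_pow m (a := √x) (by linarith) (by linarith))]
  refine add_le_add ((integral_inv_log_pow_le m hs2 (by norm_num)).trans ?_)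
    ((integral_inv_log_pow_le m hsx (by linarith)).trans ?_)
  · rw [← div_eq_mul_one_div]
    gcongr
    linarith
  · rw [log_sqrt (by linarith), div_pow, ← div_mul, mul_comm]
    gcongr
    linarith

theorem integral_inv_log_pow_eq (m : ℕ) {x : ℝ} (hx : 2 ≤ x) :
    ∫ t in (2 : ℝ)..x, 1 / log t ^ m =
      x / log x ^ m - 2 / log 2 ^ m + m * ∫ t in (2 : ℝ)..x, 1 / log t ^ (m + 1) := by
  have hI := intervalIntegrable_inv_log_pow m (a := 2) (b := x) (by norm_num) (by linarith)
  have hI' := intervalIntegrable_inv_log_pow (m + 1) (a := 2) (b := x) (by norm_num) (by linarith)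
  have h := integral_eq_sub_of_hasDerivAt (a := 2) (b := x) (f := fun t => t / log t ^ m)
    (f' := fun t => 1 / log t ^ m - m * (1 / log t ^ (m + 1))) ?_ (hI.sub (hI'.const_mul _))
  · rw [intervalIntegral.integral_sub hI (hI'.const_mul _), intervalIntegral.integral_const_mul]
      at h
    linarith
  · intro t ht
    rw [Set.uIcc_of_le hx] at ht
    have ht0 : 0 < t := by linarith [ht.1]
    have hl : 0 < log t := log_pos (by linarith [ht.1])
    have h1 := (hasDerivAt_id t).div ((hasDerivAt_log ht0.ne').pow m) (pow_pos hl m).ne'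
    refine h1.congr_deriv ?_
    rcases m with _ | m
    · simp
    · simp only [id, Nat.add_sub_cancel, Pi.pow_apply]
      field_simp
      ring

theorem exists_integral_inv_log_eq (N : ℕ) : ∃ C : ℝ, ∀ x : ℝ, 2 ≤ x →
    ∫ t in (2 : ℝ)..x, 1 / log t ^ 1 = x * ∑ j ∈ Finset.range N, j.factorial / log x ^ (j + 1)
      + N.factorial * (∫ t in (2 : ℝ)..x, 1 / log t ^ (N + 1)) + C := by
  induction N with
  | zero => exact ⟨0, fun x _ => by simp⟩
  | succ N ih =>
    obtain ⟨C, hC⟩ := ih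
    refine ⟨C - N.factorial * (2 / log 2 ^ (N + 1)), fun x hx => ?_⟩
    rw [hC x hx, integral_inv_log_pow_eq (N + 1) hx, Finset.sum_range_succ, Nat.factorial_succ]
    push_cast
    ring

/-- The asymptotic expansion of the prime counting function, from the prime number theorem with
error term `O(x / (log x) ^ N)`. -/
theorem primeCounting_sub_sum_isBigO
    (hθ : ∀ N : ℕ, ∃ C : ℝ, ∀ x : ℝ, 2 ≤ x → |Chebyshev.theta x - x| ≤ C * (x / log x ^ N))
    (N : ℕ) :
    (fun x : ℝ => (Nat.primeCounting ⌊x⌋₊ : ℝ)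
      - x * ∑ j ∈ Finset.range N, j.factorial / log x ^ (j + 1)) =O[atTop]
      fun x => x / log x ^ (N + 1) := by
  obtain ⟨C, hC⟩ := hθ N
  obtain ⟨D, hD⟩ := exists_integral_inv_log_eq N
  have h1 : (fun x : ℝ => (Chebyshev.theta x - x) / log x) =O[atTop]
      fun x => x / log x ^ (N + 1) := by
    refine IsBigO.of_bound C ?_
    filter_upwards [eventually_ge_atTop 2] with x hx
    have hl : 0 < log x := log_pos (by linarith)
    rw [norm_eq_abs, abs_div, abs_of_pos hl, norm_of_nonneg (by positivity), pow_succ, ← div_div,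
      ← mul_div_assoc]
    exact div_le_div_of_nonneg_right (hC x hx) hl.le
  have hint : ∀ x : ℝ, 2 ≤ x → IntervalIntegrable
      (fun t => Chebyshev.theta t / (t * log t ^ 2)) volume 2 x := by
    intro x hx
    refine intervalIntegrable_iff.mpr ?_
    rw [Set.uIoc_of_le hx, ← integrableOn_Icc_iff_integrableOn_Ioc]
    exact Chebyshev.integrableOn_theta_div_id_mul_log_sq x
  have h2 : (fun x : ℝ => ∫ t in (2 : ℝ)..x,
      (Chebyshev.theta t / (t * log t ^ 2) - 1 / log t ^ 2)) =O[atTop]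
      fun x => x / log x ^ (N + 1) := by
    have hJ := (integral_inv_log_pow_isBigO (N + 1)).const_mul_left (C / log 2)
    refine IsBigO.trans (IsBigO.of_bound' ?_) hJ
    filter_upwards [eventually_ge_atTop 2] with x hx
    rw [norm_eq_abs, norm_eq_abs]
    refine le_trans ?_ (le_abs_self _)
    refine (abs_integral_le_integral_abs hx).trans ?_
    rw [← intervalIntegral.integral_const_mul]
    have hI := intervalIntegrable_inv_log_pow 2 (a := 2) (b := x) (by norm_num) (by linarith)
    have hI' := intervalIntegrable_inv_log_pow (N + 1) (a := 2) (b := x) (by norm_num)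
      (by linarith)
    refine integral_mono_on hx ((hint x hx).sub hI).abs (hI'.const_mul _) fun t ht => ?_
    have ht0 : 0 < t := by linarith [ht.1]
    have hl2 : 0 < log 2 := log_pos (by norm_num)
    have hl : 0 < log t := log_pos (by linarith [ht.1])
    have hl2t : log 2 ≤ log t := log_le_log (by norm_num) ht.1
    have e : Chebyshev.theta t / (t * log t ^ 2) - 1 / log t ^ 2
        = (Chebyshev.theta t - t) / (t * log t ^ 2) := by
      field_simp
    have hC0 : 0 ≤ C * (t / log t ^ N) := (abs_nonneg _).trans (hC t ht.1)
    have hCnn : 0 ≤ C := nonneg_of_mul_nonneg_left hC0 (by positivity)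
    rw [e, abs_div, abs_of_pos (show 0 < t * log t ^ 2 by positivity)]
    calc |Chebyshev.theta t - t| / (t * log t ^ 2)
        ≤ C * (t / log t ^ N) / (t * log t ^ 2) :=
          div_le_div_of_nonneg_right (hC t ht.1) (by positivity)
      _ = C / log t * (1 / log t ^ (N + 1)) := by field_simp; ring
      _ ≤ C / log 2 * (1 / log t ^ (N + 1)) := by gcongr
  have h3 := (((h1.add h2).add ((integral_inv_log_pow_isBigO (N + 1)).const_mul_left
    (N.factorial : ℝ)))).add (const_isBigO_div_log_pow (D + 2 / log 2) (N + 1))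
  refine h3.congr' ?_ EventuallyEq.rfl
  filter_upwards [eventually_ge_atTop 2] with x hx
  have hl : 0 < log x := log_pos (by linarith)
  have hI := intervalIntegrable_inv_log_pow 2 (a := 2) (b := x) (by norm_num) (by linarith)
  rw [Chebyshev.primeCounting_eq_theta_div_log_add_integral hx,
    intervalIntegral.integral_sub (hint x hx) hI]
  have e1 := hD x hx
  have e2 := integral_inv_log_pow_eq 1 hx
  simp only [pow_one, Nat.cast_one, one_mul] at e1 e2
  rw [e2] at e1
  norm_num at e1 ⊢
  linarith [sub_div (Chebyshev.theta x) x (log x)]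

end PrimeCountingExpansion

section RiemannTail

open Topology Asymptotics Real

lemma primePi_nonneg (x : ℝ) : 0 ≤ primePi x := Nat.cast_nonneg _

lemma primeCounting_le_self (n : ℕ) : Nat.primeCounting n ≤ n := by
  induction n with
  | zero => simp
  | succ k ih =>
    simp only [Nat.primeCounting, Nat.primeCounting', Nat.count_succ _ (k + 1)] at ih ⊢
    split_ifs <;> omega

lemma primePi_le_self {x : ℝ} (hx : 0 ≤ x) : primePi x ≤ x :=
  (Nat.cast_le.2 (primeCounting_le_self _)).trans (Nat.floor_le hx)

lemma primePi_eq_zero_of_lt_two {x : ℝ} (hx : x < 2) : primePi x = 0 := by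
  have h : ⌊x⌋₊ ≤ 1 := Nat.lt_succ_iff.1 ((Nat.floor_lt' two_ne_zero).2 (by exact_mod_cast hx))
  have h1 : Nat.primeCounting ⌊x⌋₊ = 0 := Nat.primeCounting_eq_zero_iff.2 h
  simp [primePi, h1]

lemma riemannPi_summand_eq_zero {n j : ℕ} {y : ℝ} (hy : 0 < y) (hn : 1 ≤ n)
    (hj : y / log 2 ≤ j) :
    (1 / ((j : ℝ) + n)) * primePi (exp (y / ((j : ℝ) + n))) = 0 := by
  have hl : 0 < log 2 := log_pos (by norm_num)
  have hn' : (1 : ℝ) ≤ n := by exact_mod_cast hn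
  have hp : 0 < (j : ℝ) + n := by positivity
  rw [primePi_eq_zero_of_lt_two, mul_zero]
  rw [← lt_log_iff_exp_lt (by norm_num), div_lt_iff₀ hp]
  rw [div_le_iff₀ hl] at hj
  nlinarith

lemma abs_riemannPi_tail_sub_le {n : ℕ} (hn : 1 ≤ n) {y : ℝ} (hy : 0 < y) :
    |∑' j : ℕ, (1 / ((j : ℝ) + n)) * primePi (exp (y / ((j : ℝ) + n)))
      - 1 / n * primePi (exp (y / n))| ≤ (y / log 2 + 1) * exp (y / (n + 1)) := by
  have hn' : (1 : ℝ) ≤ n := by exact_mod_cast hn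
  have hl : 0 < log 2 := log_pos (by norm_num)
  set g : ℕ → ℝ := fun j => (1 / ((j : ℝ) + n)) * primePi (exp (y / ((j : ℝ) + n))) with hg
  have hz : ∀ j ∉ Finset.range (⌈y / log 2⌉₊), g j = 0 := fun j hj =>
    riemannPi_summand_eq_zero hy hn (Nat.ceil_le.1 (not_lt.1 (by simpa using hj)))
  have hs : Summable g := summable_of_ne_finset_zero hz
  have h0 : g 0 = 1 / n * primePi (exp (y / n)) := by simp [hg]
  have hz' : ∀ j ∉ Finset.range (⌈y / log 2⌉₊), g (j + 1) = 0 := fun j hj =>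
    hz _ (by simp at hj ⊢; linarith)
  rw [show ∑' j, g j = g 0 + ∑' j, g (j + 1) from hs.tsum_eq_zero_add, h0, add_sub_cancel_left,
    tsum_eq_sum hz']
  have hb : ∀ j ∈ Finset.range (⌈y / log 2⌉₊), |g (j + 1)| ≤ exp (y / (n + 1)) := by
    intro j _
    have hp : (1 : ℝ) ≤ ((j + 1 : ℕ) : ℝ) + n := by
      push_cast
      linarith [(Nat.cast_nonneg j : (0 : ℝ) ≤ j)]
    have h1 : 1 / (((j + 1 : ℕ) : ℝ) + n) ≤ 1 := by
      rw [div_le_one (by linarith)]; exact hp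
    have h2 : primePi (exp (y / (((j + 1 : ℕ) : ℝ) + n))) ≤ exp (y / (n + 1)) := by
      refine (primePi_le_self (exp_pos _).le).trans (exp_le_exp.2 ?_)
      refine div_le_div_of_nonneg_left hy.le (by linarith) ?_
      push_cast; linarith [(Nat.cast_nonneg j : (0 : ℝ) ≤ j)]
    have h3 := primePi_nonneg (exp (y / (((j + 1 : ℕ) : ℝ) + n)))
    rw [abs_of_nonneg (mul_nonneg (by positivity) h3)]
    calc _ ≤ 1 * primePi (exp (y / (((j + 1 : ℕ) : ℝ) + n))) := by gcongr
      _ ≤ _ := by rwa [one_mul]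
  refine (Finset.abs_sum_le_sum_abs _ _).trans ((Finset.sum_le_card_nsmul _ _ _ hb).trans ?_)
  rw [Finset.card_range, nsmul_eq_mul]
  gcongr
  exact (Nat.ceil_lt_add_one (by positivity)).le

lemma exp_neg_mul_linear_isBigO {δ : ℝ} (hδ : 0 < δ) (A : ℝ) (N : ℕ) :
    (fun y => (y / A + 1) * exp (-δ * y)) =O[atTop] fun y => 1 / y ^ N := by
  have h1 := (isLittleO_exp_neg_mul_rpow_atTop hδ (-((N + 1 : ℕ) : ℝ))).isBigO
  have h2 : (fun y : ℝ => y / A + 1) =O[atTop] fun y => y := by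
    refine IsBigO.add ?_ ?_
    · simpa [div_eq_inv_mul] using (isBigO_refl (fun y : ℝ => y) atTop).const_mul_left A⁻¹
    · refine IsBigO.of_bound' ?_
      filter_upwards [eventually_ge_atTop 1] with y hy
      simpa using hy.trans (le_abs_self y)
  refine (h2.mul h1).congr' EventuallyEq.rfl ?_
  filter_upwards [eventually_gt_atTop 0] with y hy
  rw [rpow_neg hy.le, rpow_natCast, pow_succ]
  field_simp

theorem hasInvExpansion_riemannPi_tail {n : ℕ} (hn : 1 ≤ n)
    (hπ : ∀ N : ℕ, (fun x : ℝ => (Nat.primeCounting ⌊x⌋₊ : ℝ)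
      - x * ∑ j ∈ Finset.range N, (j.factorial : ℝ) / log x ^ (j + 1)) =O[atTop]
        fun x => x / log x ^ (N + 1)) :
    HasInvExpansion (fun y => exp (-(y / n)) *
      ∑' j : ℕ, (1 / ((j : ℝ) + n)) * primePi (exp (y / ((j : ℝ) + n))))
      fun j => (n : ℝ) ^ j * j.factorial := by
  have hn0 : (0 : ℝ) < n := by exact_mod_cast hn
  intro N
  have hlim : Tendsto (fun y : ℝ => exp (y / n)) atTop atTop :=
    tendsto_exp_atTop.comp (tendsto_id.atTop_div_const hn0)
  have h1 := ((hπ N).comp_tendsto hlim).mul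
    (isBigO_refl (fun y : ℝ => 1 / n * exp (-(y / n))) atTop)
  have hδ : (0 : ℝ) < 1 / n - 1 / (n + 1) := by
    rw [sub_pos]; exact one_div_lt_one_div_of_lt hn0 (by linarith)
  have h2 : (fun y : ℝ => exp (-(y / n)) *
      (∑' j : ℕ, (1 / ((j : ℝ) + n)) * primePi (exp (y / ((j : ℝ) + n)))
      - 1 / n * primePi (exp (y / n)))) =O[atTop] fun y => 1 / y ^ (N + 1) := by
    refine IsBigO.trans (IsBigO.of_bound' ?_) (exp_neg_mul_linear_isBigO hδ (log 2) (N + 1))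
    filter_upwards [eventually_gt_atTop 0] with y hy
    rw [norm_eq_abs, abs_mul, abs_of_pos (exp_pos _)]
    calc _ ≤ exp (-(y / n)) * ((y / log 2 + 1) * exp (y / (n + 1))) := by
          gcongr; exact abs_riemannPi_tail_sub_le hn hy
      _ = (y / log 2 + 1) * exp (-(1 / n - 1 / (n + 1)) * y) := by
          rw [mul_left_comm, ← exp_add]; congr 2; ring
      _ ≤ _ := le_abs_self _
  have h3 : (fun y : ℝ => 1 / n * exp (-(y / n)) * (primePi (exp (y / n))
      - exp (y / n) * ∑ j ∈ Finset.range N, (j.factorial : ℝ) / (y / n) ^ (j + 1))) =O[atTop]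
        fun y => 1 / y ^ (N + 1) := by
    have h4 : (fun y : ℝ => (n : ℝ) ^ N * (1 / y ^ (N + 1))) =O[atTop] fun y => 1 / y ^ (N + 1) :=
      (isBigO_refl _ _).const_mul_left _
    refine (h1.congr ?_ ?_).trans h4
    · intro y; simp [primePi]; ring
    · intro y
      have e : exp (y / n) * exp (-(y / n)) = 1 := by rw [← exp_add]; simp
      simp only [Function.comp, log_exp]
      calc _ = (exp (y / n) * exp (-(y / n))) * (1 / n) / (y / n) ^ (N + 1) := by ring
        _ = _ := by rw [e, div_pow]; field_simp; ring
  refine (h2.add h3).congr_left fun y => ?_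
  have e : exp (-(y / n)) * exp (y / n) = 1 := by rw [← exp_add]; simp
  have e2 : ∑ j ∈ Finset.range N, (n : ℝ) ^ j * (j.factorial : ℝ) / y ^ (j + 1)
      = 1 / n * ∑ j ∈ Finset.range N, (j.factorial : ℝ) / (y / n) ^ (j + 1) := by
    rw [Finset.mul_sum]
    refine Finset.sum_congr rfl fun j _ => ?_
    rw [div_pow]; field_simp; ring
  rw [e2]
  linear_combination (-(1 / n * ∑ j ∈ Finset.range N, (j.factorial : ℝ) / (y / n) ^ (j + 1))) * e

end RiemannTail

section ZetaGrowth

open Topology Complex Set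

/-- The terms of a series for `(s - 1) ζ(s) - 1` that converges for `0 < re s`. -/
noncomputable def zetaTerm (n : ℕ) (s : ℂ) : ℂ :=
  (s - 1) * ((n + 1 : ℝ) : ℂ) ^ (-s) + ((n + 2 : ℝ) : ℂ) ^ (1 - s) - ((n + 1 : ℝ) : ℂ) ^ (1 - s)

lemma differentiable_zetaTerm (n : ℕ) : Differentiable ℂ (zetaTerm n) := by
  have h1 : ((n + 1 : ℝ) : ℂ) ≠ 0 := by exact_mod_cast (by positivity : (n + 1 : ℝ) ≠ 0)
  have h2 : ((n + 2 : ℝ) : ℂ) ≠ 0 := by exact_mod_cast (by positivity : (n + 2 : ℝ) ≠ 0)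
  unfold zetaTerm
  intro s
  refine DifferentiableAt.sub (DifferentiableAt.add (DifferentiableAt.mul (by fun_prop) ?_) ?_) ?_
  · exact DifferentiableAt.const_cpow (by fun_prop) (Or.inl h1)
  · exact DifferentiableAt.const_cpow (by fun_prop) (Or.inl h2)
  · exact DifferentiableAt.const_cpow (by fun_prop) (Or.inl h1)

lemma hasDerivAt_ofReal_cpow_const_of_pos {x : ℝ} (hx : 0 < x) (r : ℂ) :
    HasDerivAt (fun y : ℝ => (y : ℂ) ^ r) (r * (x : ℂ) ^ (r - 1)) x := by
  by_cases hr : r = 0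
  · simpa [hr] using hasDerivAt_const x (1 : ℂ)
  · exact hasDerivAt_ofReal_cpow_const hx.ne' hr

lemma norm_cpow_neg_sub_le {s : ℂ} (hs : 0 < s.re) {m x : ℝ} (hm : 0 < m) (h : x ∈ Icc m (m + 1)) :
    ‖(x : ℂ) ^ (-s) - (m : ℂ) ^ (-s)‖ ≤ ‖s‖ * m ^ (-s.re - 1) := by
  have key := norm_image_sub_le_of_norm_deriv_le_segment' (a := m) (b := m + 1)
    (f := fun y : ℝ => (y : ℂ) ^ (-s)) (f' := fun y : ℝ => -s * (y : ℂ) ^ (-s - 1))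
    (C := ‖s‖ * m ^ (-s.re - 1))
    (fun y hy => (hasDerivAt_ofReal_cpow_const_of_pos (hm.trans_le hy.1) _).hasDerivWithinAt)
    (fun y hy => by
      rw [norm_mul, norm_neg, norm_cpow_eq_rpow_re_of_pos (hm.trans_le hy.1)]
      gcongr ?_ * ?_
      simpa using Real.rpow_le_rpow_of_nonpos hm hy.1 (by linarith : -s.re - 1 ≤ 0)) x h
  refine key.trans (mul_le_of_le_one_right (by positivity) (by linarith [h.2]))

lemma norm_zetaTerm_le {s : ℂ} (hs : 0 < s.re) (n : ℕ) :
    ‖zetaTerm n s‖ ≤ ‖s - 1‖ * ‖s‖ * (n + 1 : ℝ) ^ (-s.re - 1) := by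
  have hm : (0 : ℝ) < n + 1 := by positivity
  have key := norm_image_sub_le_of_norm_deriv_le_segment' (a := (n + 1 : ℝ)) (b := (n + 1 : ℝ) + 1)
    (f := fun y : ℝ => (s - 1) * ((n + 1 : ℝ) : ℂ) ^ (-s) * ((y : ℂ) - ((n + 1 : ℝ) : ℂ))
      + (y : ℂ) ^ (1 - s))
    (f' := fun y : ℝ => (s - 1) * ((n + 1 : ℝ) : ℂ) ^ (-s) * 1 + (1 - s) * (y : ℂ) ^ (1 - s - 1))
    (C := ‖s - 1‖ * ‖s‖ * (n + 1 : ℝ) ^ (-s.re - 1))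
    (fun y hy => by
      refine HasDerivAt.hasDerivWithinAt (HasDerivAt.add ?_
        (hasDerivAt_ofReal_cpow_const_of_pos (hm.trans_le hy.1) _))
      exact ((Complex.ofRealCLM.hasDerivAt (x := y)).sub_const _).const_mul _)
    (fun y hy => by
      have e : (s - 1) * ((n + 1 : ℝ) : ℂ) ^ (-s) * 1 + (1 - s) * (y : ℂ) ^ (1 - s - 1)
          = -((s - 1) * ((y : ℂ) ^ (-s) - ((n + 1 : ℝ) : ℂ) ^ (-s))) := by
        rw [show 1 - s - 1 = -s by ring]; ring
      rw [e, norm_neg, norm_mul, mul_assoc]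
      gcongr
      exact norm_cpow_neg_sub_le hs hm ⟨hy.1, hy.2.le⟩) ((n + 1 : ℝ) + 1) (by simp)
  refine le_trans (le_of_eq ?_) (key.trans (le_of_eq (by ring)))
  congr 1
  unfold zetaTerm
  push_cast
  ring_nf

lemma summable_nat_add_one_rpow {p : ℝ} (hp : p < -1) :
    Summable fun n : ℕ => (n + 1 : ℝ) ^ p := by
  have := (summable_nat_add_iff 1).2 (Real.summable_nat_rpow.2 hp)
  simpa using this

lemma differentiableOn_tsum_zetaTerm :
    DifferentiableOn ℂ (fun s => ∑' n, zetaTerm n s) {s | 0 < s.re} := by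
  intro s hs
  simp only [mem_ofPred_eq] at hs
  set U : Set ℂ := {w | s.re / 2 < w.re} ∩ Metric.ball 0 (‖s‖ + 1) with hU
  have hUo : IsOpen U := (isOpen_lt continuous_const continuous_re).inter Metric.isOpen_ball
  have hsU : s ∈ U := ⟨by simp only [mem_ofPred_eq]; linarith, by simp⟩
  have hsum : Summable fun n : ℕ =>
      (‖s‖ + 2) * (‖s‖ + 1) * (n + 1 : ℝ) ^ (-(s.re / 2) - 1) :=
    (summable_nat_add_one_rpow (by linarith)).mul_left _
  refine ((differentiableOn_tsum_of_summable_norm hsum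
    (fun i => (differentiable_zetaTerm i).differentiableOn) hUo fun i w hw => ?_).differentiableAt
      (hUo.mem_nhds hsU)).differentiableWithinAt
  have hw1 : s.re / 2 < w.re := hw.1
  have hw2 : ‖w‖ < ‖s‖ + 1 := by simpa using hw.2
  have hw3 : ‖w - 1‖ ≤ ‖s‖ + 2 := (norm_sub_le _ _).trans (by simp; linarith)
  refine (norm_zetaTerm_le (by linarith) i).trans ?_
  gcongr
  · linarith [(Nat.cast_nonneg i : (0 : ℝ) ≤ i)]

lemma sum_zetaTerm (N : ℕ) (s : ℂ) :
    ∑ n ∈ Finset.range N, zetaTerm n s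
      = (s - 1) * ∑ n ∈ Finset.range N, ((n + 1 : ℝ) : ℂ) ^ (-s)
        + ((N + 1 : ℝ) : ℂ) ^ (1 - s) - 1 := by
  induction N with
  | zero => simp
  | succ k ih =>
    rw [Finset.sum_range_succ, ih, Finset.sum_range_succ, zetaTerm]
    push_cast
    ring_nf

lemma summable_zetaTerm {s : ℂ} (hs : 0 < s.re) : Summable fun n => zetaTerm n s :=
  Summable.of_norm_bounded ((summable_nat_add_one_rpow (by linarith)).mul_left _)
    (norm_zetaTerm_le hs)

lemma riemannZeta₁_eq_one_add_tsum_of_one_lt_re {s : ℂ} (hs : 1 < s.re) :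
    riemannZeta₁ s = 1 + ∑' n, zetaTerm n s := by
  have hs1 : s ≠ 1 := fun h => by simp [h] at hs
  have h0 : s - 1 ≠ 0 := sub_ne_zero.2 hs1
  have h1 := (summable_zetaTerm (s := s) (by linarith)).hasSum.tendsto_sum_nat
  have h2 : Summable fun n : ℕ => ((n + 1 : ℝ) : ℂ) ^ (-s) := by
    refine Summable.of_norm_bounded (summable_nat_add_one_rpow (p := -s.re) (by linarith))
      fun n => ?_
    rw [norm_cpow_eq_rpow_re_of_pos (by positivity)]; simp
  have h3 : riemannZeta s = ∑' n : ℕ, ((n + 1 : ℝ) : ℂ) ^ (-s) := by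
    rw [zeta_eq_tsum_one_div_nat_add_one_cpow hs]
    congr with n
    rw [cpow_neg, one_div]; push_cast; rfl
  have h4 : Tendsto (fun N : ℕ => ((N + 1 : ℝ) : ℂ) ^ (1 - s)) atTop (𝓝 0) := by
    rw [tendsto_zero_iff_norm_tendsto_zero]
    have h5 : Tendsto (fun N : ℕ => (N + 1 : ℝ)) atTop atTop :=
      tendsto_atTop_add_const_right _ _ tendsto_natCast_atTop_atTop
    refine ((tendsto_rpow_neg_atTop (y := s.re - 1) (by linarith)).comp h5).congr fun N => ?_
    rw [norm_cpow_eq_rpow_re_of_pos (by positivity)]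
    simp
  have h5 := (((h2.hasSum.tendsto_sum_nat.const_mul (s - 1)).add h4).sub_const 1)
  have h6 := tendsto_nhds_unique h1 (h5.congr fun N => (sum_zetaTerm N s).symm)
  rw [h6, ← h3, riemannZeta_eq_inv_sub_mul hs1]
  field_simp
  ring

lemma riemannZeta₁_eq_one_add_tsum {s : ℂ} (hs : 0 < s.re) :
    riemannZeta₁ s = 1 + ∑' n, zetaTerm n s := by
  have hUo : IsOpen {s : ℂ | 0 < s.re} := isOpen_lt continuous_const continuous_re
  have h1 : AnalyticOnNhd ℂ riemannZeta₁ {s | 0 < s.re} :=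
    differentiable_riemannZeta₁.differentiableOn.analyticOnNhd hUo
  have h2 : AnalyticOnNhd ℂ (fun s => 1 + ∑' n, zetaTerm n s) {s | 0 < s.re} :=
    (differentiableOn_tsum_zetaTerm.const_add 1).analyticOnNhd hUo
  refine h1.eqOn_of_preconnected_of_eventuallyEq h2 (convex_halfSpace_re_gt 0).isPreconnected
    (z₀ := 2) (by simp) ?_ hs
  filter_upwards [(isOpen_lt continuous_const continuous_re).mem_nhds
    (show (2 : ℂ) ∈ {s : ℂ | 1 < s.re} by simp)] with w hw
  exact riemannZeta₁_eq_one_add_tsum_of_one_lt_re hw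

/-- `2 + |im s|`, the quantity in which vertical growth is measured. -/
noncomputable def vert (s : ℂ) : ℝ := 2 + |s.im|

lemma two_le_vert (s : ℂ) : 2 ≤ vert s := by unfold vert; linarith [abs_nonneg s.im]

lemma vert_pos (s : ℂ) : 0 < vert s := by linarith [two_le_vert s]

lemma norm_riemannZeta₁_le_of_nat {s : ℂ} {δ : ℝ} (hδ : 0 < δ) (hδ1 : δ < 1 / 2)
    (hs : 1 - δ ≤ s.re) (N : ℕ) :
    ‖riemannZeta₁ s‖ ≤ (N + 1 : ℝ) ^ δ + ‖s - 1‖ * (1 + ‖s‖ / (N + 1)) * (N + 1 : ℝ) ^ (2 * δ)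
      * ∑' n : ℕ, (n + 1 : ℝ) ^ (-1 - δ) := by
  have hre : 0 < s.re := by linarith
  set Z := ∑' n : ℕ, (n + 1 : ℝ) ^ (-1 - δ) with hZ
  have hsZ := summable_nat_add_one_rpow (p := -1 - δ) (by linarith)
  have hN : (0 : ℝ) < N + 1 := by positivity
  have e : riemannZeta₁ s = (s - 1) * ∑ n ∈ Finset.range N, ((n + 1 : ℝ) : ℂ) ^ (-s)
        + ((N + 1 : ℝ) : ℂ) ^ (1 - s) + ∑' n, zetaTerm (n + N) s := by
    rw [riemannZeta₁_eq_one_add_tsum hre, ← (summable_zetaTerm hre).sum_add_tsum_nat_add N,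
      sum_zetaTerm]
    ring
  have b1 : ‖∑ n ∈ Finset.range N, ((n + 1 : ℝ) : ℂ) ^ (-s)‖ ≤ (N + 1 : ℝ) ^ (2 * δ) * Z := by
    refine (norm_sum_le _ _).trans ?_
    refine le_trans (Finset.sum_le_sum (g := fun n : ℕ => (N + 1 : ℝ) ^ (2 * δ) *
      (n + 1 : ℝ) ^ (-1 - δ)) fun n hn => ?_) ?_
    · have hn1 : (1 : ℝ) ≤ n + 1 := by linarith [(Nat.cast_nonneg n : (0 : ℝ) ≤ n)]
      have hnN : (n + 1 : ℝ) ≤ N + 1 := by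
        have := (Finset.mem_range.1 hn).le
        have : (n : ℝ) ≤ N := by exact_mod_cast this
        linarith
      rw [norm_cpow_eq_rpow_re_of_pos (by positivity)]
      calc (n + 1 : ℝ) ^ (-s).re ≤ (n + 1 : ℝ) ^ (2 * δ + (-1 - δ)) :=
            Real.rpow_le_rpow_of_exponent_le hn1 (by simp; linarith)
        _ = (n + 1 : ℝ) ^ (2 * δ) * (n + 1 : ℝ) ^ (-1 - δ) := Real.rpow_add (by positivity) _ _
        _ ≤ _ := by gcongr
    · rw [← Finset.mul_sum]
      gcongr
      exact hsZ.sum_le_tsum _ fun n _ => by positivity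
  have b2 : ‖((N + 1 : ℝ) : ℂ) ^ (1 - s)‖ ≤ (N + 1 : ℝ) ^ δ := by
    rw [norm_cpow_eq_rpow_re_of_pos hN]
    exact Real.rpow_le_rpow_of_exponent_le (by linarith [(Nat.cast_nonneg N : (0 : ℝ) ≤ N)])
      (by simp; linarith)
  have b3 : ‖∑' n, zetaTerm (n + N) s‖ ≤
      ‖s - 1‖ * ‖s‖ * ((N + 1 : ℝ) ^ (2 * δ - 1) * Z) := by
    refine (tsum_of_norm_bounded (g := fun n : ℕ => ‖s - 1‖ * ‖s‖ * ((N + 1 : ℝ) ^ (2 * δ - 1) *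
      (n + N + 1 : ℝ) ^ (-1 - δ))) (a := ‖s - 1‖ * ‖s‖ * ((N + 1 : ℝ) ^ (2 * δ - 1) *
      ∑' n : ℕ, (n + N + 1 : ℝ) ^ (-1 - δ))) ?_ fun n => ?_).trans ?_
    · have := (summable_nat_add_iff N).2 hsZ
      push_cast at this
      exact (this.hasSum.mul_left _).mul_left _
    · refine (norm_zetaTerm_le hre _).trans ?_
      push_cast
      have hn1 : (1 : ℝ) ≤ n + N + 1 := by
        linarith [(Nat.cast_nonneg n : (0 : ℝ) ≤ n), (Nat.cast_nonneg N : (0 : ℝ) ≤ N)]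
      gcongr
      calc (n + N + 1 : ℝ) ^ (-s.re - 1) ≤ (n + N + 1 : ℝ) ^ ((2 * δ - 1) + (-1 - δ)) :=
            Real.rpow_le_rpow_of_exponent_le hn1 (by linarith)
        _ = (n + N + 1 : ℝ) ^ (2 * δ - 1) * (n + N + 1 : ℝ) ^ (-1 - δ) :=
            Real.rpow_add (by positivity) _ _
        _ ≤ _ := by
            gcongr ?_ * _
            exact Real.rpow_le_rpow_of_nonpos hN
              (by linarith [(Nat.cast_nonneg n : (0 : ℝ) ≤ n)]) (by linarith)
    · gcongr
      have := hsZ.sum_add_tsum_nat_add N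
      push_cast at this
      rw [hZ, ← this]
      exact le_add_of_nonneg_left (Finset.sum_nonneg fun n _ => by positivity)
  rw [e]
  refine (norm_add_le _ _).trans ((add_le_add ((norm_add_le _ _).trans
    (add_le_add ((norm_mul_le _ _).trans (mul_le_mul_of_nonneg_left b1 (norm_nonneg _))) b2))
    b3).trans (le_of_eq ?_))
  rw [Real.rpow_sub_one hN.ne']
  field_simp
  ring

lemma exists_norm_riemannZeta₁_le {δ : ℝ} (hδ : 0 < δ) (hδ1 : δ ≤ 1) :
    ∃ C, 0 < C ∧ ∀ s : ℂ, 1 - δ / 4 ≤ s.re → s.re ≤ 4 →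
      ‖riemannZeta₁ s‖ ≤ C * vert s ^ (1 + δ) := by
  set Z := ∑' n : ℕ, (n + 1 : ℝ) ^ (-1 - δ / 4) with hZ
  have hZ0 : 0 ≤ Z := tsum_nonneg fun n => by positivity
  refine ⟨2 + 3 * 4 * 2 * Z, by positivity, fun s hs hs4 => ?_⟩
  have hT2 := two_le_vert s
  set T := vert s with hT
  have hN1 : T ≤ ⌈T⌉₊ := Nat.le_ceil _
  have hN2 : (⌈T⌉₊ : ℝ) < T + 1 := Nat.ceil_lt_add_one (by linarith)
  have h1 := norm_riemannZeta₁_le_of_nat (δ := δ / 4) (by linarith) (by linarith) hs ⌈T⌉₊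
  have hsn : ‖s‖ ≤ 3 * T := by
    refine (norm_le_abs_re_add_abs_im s).trans ?_
    rw [abs_of_nonneg (by linarith)]
    have : |s.im| = T - 2 := by rw [hT, vert]; ring
    linarith
  have hsn1 : ‖s - 1‖ ≤ 3 * T := by
    refine (norm_le_abs_re_add_abs_im _).trans ?_
    have h2 : |s.im| = T - 2 := by rw [hT, vert]; ring
    have h3 : |s.re - 1| ≤ 3 := abs_le.2 ⟨by linarith, by linarith⟩
    simp only [sub_re, one_re, sub_im, one_im, sub_zero]
    linarith
  set M : ℝ := (⌈T⌉₊ : ℝ) + 1 with hM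
  have hM0 : 0 < M := by positivity
  have hMT : M ≤ T * T := by nlinarith
  have hq : ‖s‖ / M ≤ 3 := by
    rw [div_le_iff₀ hM0]; nlinarith
  have hp1 : M ^ (δ / 4) ≤ 2 * T ^ (1 + δ) := by
    calc M ^ (δ / 4) ≤ (T * T) ^ (δ / 4) := by gcongr
      _ = T ^ (δ / 2) := by
          rw [← sq, ← Real.rpow_natCast, ← Real.rpow_mul (by linarith)]; congr 1; push_cast; ring
      _ ≤ T ^ (1 + δ) := Real.rpow_le_rpow_of_exponent_le (by linarith) (by linarith)
      _ ≤ _ := by linarith [Real.rpow_nonneg (by linarith : 0 ≤ T) (1 + δ)]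
  have hp2 : M ^ (2 * (δ / 4)) ≤ T ^ δ := by
    calc M ^ (2 * (δ / 4)) ≤ (T * T) ^ (2 * (δ / 4)) := by gcongr
      _ = T ^ δ := by
          rw [← sq, ← Real.rpow_natCast, ← Real.rpow_mul (by linarith)]; congr 1; push_cast; ring
  calc ‖riemannZeta₁ s‖ ≤ M ^ (δ / 4) + ‖s - 1‖ * (1 + ‖s‖ / M) * M ^ (2 * (δ / 4)) * Z := h1
    _ ≤ 2 * T ^ (1 + δ) + (3 * T) * (1 + 3) * T ^ δ * Z := by gcongr
    _ ≤ 2 * T ^ (1 + δ) + (3 * T) * (1 + 3) * T ^ δ * Z + 12 * Z * T ^ (1 + δ) := by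
        have := Real.rpow_nonneg (by linarith : 0 ≤ T) (1 + δ)
        have : 0 ≤ 12 * Z * T ^ (1 + δ) := by positivity
        linarith
    _ = (2 + 3 * 4 * 2 * Z) * T ^ (1 + δ) := by
        rw [Real.rpow_add (by linarith), Real.rpow_one]; ring

lemma vert_le_two_mul {s w : ℂ} (h : ‖s - w‖ ≤ 1) : vert s ≤ 2 * vert w := by
  have h1 : |s.im - w.im| ≤ 1 := le_trans (by simpa using abs_im_le_norm (s - w)) h
  have h2 : |s.im| ≤ |w.im| + |s.im - w.im| := by
    have := abs_add_le w.im (s.im - w.im); simpa using this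
  unfold vert
  linarith [abs_nonneg w.im]

lemma exists_norm_deriv_riemannZeta₁_le {δ : ℝ} (hδ : 0 < δ) (hδ1 : δ ≤ 1) :
    ∃ C, 0 < C ∧ ∀ s : ℂ, 1 - δ / 8 ≤ s.re → s.re ≤ 7 / 2 →
      ‖deriv riemannZeta₁ s‖ ≤ C * vert s ^ (1 + δ) := by
  obtain ⟨C, hC, h⟩ := exists_norm_riemannZeta₁_le hδ hδ1
  refine ⟨C * 2 ^ (1 + δ) / (δ / 8), by positivity, fun s hs hs4 => ?_⟩
  have hT := vert_pos s
  refine (norm_deriv_le_of_forall_mem_sphere_norm_le (R := δ / 8)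
    (C := C * (2 * vert s) ^ (1 + δ)) (by positivity)
    differentiable_riemannZeta₁.diffContOnCl fun z hz => ?_).trans (le_of_eq ?_)
  · have hz' : ‖z - s‖ = δ / 8 := by simpa using hz
    have h1 : |z.re - s.re| ≤ δ / 8 := le_trans (by simpa using abs_re_le_norm (z - s)) hz'.le
    have h2 := abs_le.1 h1
    refine (h z (by linarith) (by linarith)).trans ?_
    have h3 := vert_le_two_mul (s := z) (w := s) (by linarith)
    have h4 := vert_pos z
    gcongr
  · rw [Real.mul_rpow (by norm_num) hT.le]; ring

end ZetaGrowth

section ZetaLowerBound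

open Topology Complex Set Metric

lemma one_le_norm_riemannZeta_product {x : ℝ} (hx : 0 < x) (y : ℝ) :
    1 ≤ ‖riemannZeta (1 + x)‖ ^ 3 * ‖riemannZeta (1 + x + I * y)‖ ^ 4
      * ‖riemannZeta (1 + x + 2 * I * y)‖ := by
  have := DirichletCharacter.norm_LFunction_product_ge_one (N := 1) 1 hx y
  simpa [DirichletCharacter.LFunctionTrivChar] using this

lemma norm_riemannZeta₁_product_ge {x : ℝ} (hx : 0 < x) (y : ℝ) :
    x ^ 3 * |y| ^ 5 ≤ ‖riemannZeta₁ (1 + x)‖ ^ 3 * ‖riemannZeta₁ (1 + x + I * y)‖ ^ 4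
      * ‖riemannZeta₁ (1 + x + 2 * I * y)‖ := by
  have hne : ∀ z : ℂ, z.re = 1 + x → z ≠ 1 := fun z hz h => by
    rw [h, one_re] at hz; linarith
  have e : ∀ z : ℂ, z.re = 1 + x → ‖riemannZeta₁ z‖ = ‖z - 1‖ * ‖riemannZeta z‖ := by
    intro z hz
    have h0 : z - 1 ≠ 0 := sub_ne_zero.2 (hne z hz)
    rw [riemannZeta_eq_inv_sub_mul (hne z hz), ← norm_mul, mul_inv_cancel_left₀ h0]
  rw [e (1 + x) (by simp), e (1 + x + I * y) (by simp), e (1 + x + 2 * I * y) (by simp)]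
  have h1 : x ≤ ‖(1 + x : ℂ) - 1‖ := by simp [abs_of_pos hx]
  have h2 : |y| ≤ ‖(1 + x + I * y : ℂ) - 1‖ := by
    simpa using abs_im_le_norm ((1 + x + I * y : ℂ) - 1)
  have h3 : |y| ≤ ‖(1 + x + 2 * I * y : ℂ) - 1‖ := by
    have := abs_im_le_norm ((1 + x + 2 * I * y : ℂ) - 1)
    simp [abs_mul] at this
    linarith [abs_nonneg y]
  have h4 := one_le_norm_riemannZeta_product hx y
  calc x ^ 3 * |y| ^ 5 = x ^ 3 * |y| ^ 4 * |y| * 1 := by ring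
    _ ≤ ‖(1 + x : ℂ) - 1‖ ^ 3 * ‖(1 + x + I * y : ℂ) - 1‖ ^ 4 * ‖(1 + x + 2 * I * y : ℂ) - 1‖ *
      (‖riemannZeta (1 + x)‖ ^ 3 * ‖riemannZeta (1 + x + I * y)‖ ^ 4
      * ‖riemannZeta (1 + x + 2 * I * y)‖) := by gcongr
    _ = _ := by ring

lemma riemannZeta₁_ne_zero {s : ℂ} (hs : 1 ≤ s.re) : riemannZeta₁ s ≠ 0 := by
  rcases eq_or_ne s 1 with rfl | h
  · simp
  · intro h0
    exact riemannZeta_ne_zero_of_one_le_re hs (by rw [riemannZeta_eq_inv_sub_mul h, h0, mul_zero])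

lemma vert_le_three_mul {s : ℂ} (h : 1 ≤ |s.im|) : vert s ≤ 3 * |s.im| := by
  unfold vert; linarith

lemma exists_le_norm_riemannZeta₁_pow_four {δ : ℝ} (hδ : 0 < δ) (hδ1 : δ ≤ 1) :
    ∃ c, 0 < c ∧ ∀ s : ℂ, 1 < s.re → s.re ≤ 3 → 1 ≤ |s.im| →
      c * ((s.re - 1) ^ 3 * vert s ^ (4 - δ)) ≤ ‖riemannZeta₁ s‖ ^ 4 := by
  obtain ⟨C, hC, h⟩ := exists_norm_riemannZeta₁_le hδ hδ1
  refine ⟨1 / (3 ^ 5 * ((C * 2 ^ (1 + δ)) ^ 3 * (C * 2 ^ (1 + δ)))), by positivity,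
    fun s hs hs3 hi => ?_⟩
  have hT := vert_pos s
  have key := norm_riemannZeta₁_product_ge (x := s.re - 1) (by linarith) s.im
  have e1 : (1 + ((s.re - 1 : ℝ) : ℂ)) = (s.re : ℂ) := by push_cast; ring
  have e2 : (s.re : ℂ) + I * s.im = s := by rw [mul_comm]; exact re_add_im s
  rw [e1, e2] at key
  have b1 : ‖riemannZeta₁ s.re‖ ≤ C * 2 ^ (1 + δ) := by
    have := h (s.re : ℂ) (by simp; linarith) (by simp; linarith)
    simpa [vert] using this
  have b2 : ‖riemannZeta₁ (s.re + 2 * I * s.im)‖ ≤ C * 2 ^ (1 + δ) * vert s ^ (1 + δ) := by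
    refine (h _ (by simp; linarith) (by simp; linarith)).trans ?_
    rw [mul_assoc C, ← Real.mul_rpow (by norm_num) hT.le]
    have h3 : vert (s.re + 2 * I * s.im) ≤ 2 * vert s := by
      unfold vert; simp [abs_mul]; linarith
    have := vert_pos (s.re + 2 * I * s.im)
    gcongr
  have hv := vert_le_three_mul hi
  have k1 : (s.re - 1) ^ 3 * vert s ^ 5 ≤ 3 ^ 5 * ((C * 2 ^ (1 + δ)) ^ 3 * (C * 2 ^ (1 + δ))) *
      vert s ^ (1 + δ) * ‖riemannZeta₁ s‖ ^ 4 := by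
    have hp : 0 ≤ s.re - 1 := by linarith
    calc (s.re - 1) ^ 3 * vert s ^ 5 ≤ (s.re - 1) ^ 3 * (3 * |s.im|) ^ 5 := by gcongr
      _ = 3 ^ 5 * ((s.re - 1) ^ 3 * |s.im| ^ 5) := by ring
      _ ≤ 3 ^ 5 * (‖riemannZeta₁ s.re‖ ^ 3 * ‖riemannZeta₁ s‖ ^ 4
          * ‖riemannZeta₁ (s.re + 2 * I * s.im)‖) := by gcongr
      _ ≤ 3 ^ 5 * ((C * 2 ^ (1 + δ)) ^ 3 * ‖riemannZeta₁ s‖ ^ 4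
          * (C * 2 ^ (1 + δ) * vert s ^ (1 + δ))) := by gcongr
      _ = _ := by ring
  have e3 : vert s ^ 5 = vert s ^ (4 - δ) * vert s ^ (1 + δ) := by
    rw [← Real.rpow_add hT, ← Real.rpow_natCast]; congr 1; push_cast; ring
  rw [e3, ← mul_assoc] at k1
  have hTd : 0 < vert s ^ (1 + δ) := Real.rpow_pos_of_pos hT _
  rw [one_div_mul_eq_div, div_le_iff₀ (by positivity)]
  refine le_of_mul_le_mul_right (k1.trans (le_of_eq ?_)) hTd
  ring

lemma exists_le_norm_riemannZeta₁_of_one_le_abs_im {δ : ℝ} (hδ : 0 < δ) (hδ1 : δ ≤ 1) :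
    ∃ c, 0 < c ∧ ∀ s : ℂ, 1 < s.re → s.re ≤ 2 → 1 ≤ |s.im| →
      c * vert s ^ (1 - 4 * δ) ≤ ‖riemannZeta₁ s‖ := by
  obtain ⟨c₀, hc₀, h₀⟩ := exists_le_norm_riemannZeta₁_pow_four hδ hδ1
  obtain ⟨C, hC, hd⟩ := exists_norm_deriv_riemannZeta₁_le hδ hδ1
  obtain ⟨c, hc, rfl⟩ : ∃ c : ℝ, 0 < c ∧ c ^ 4 = c₀ :=
    ⟨c₀ ^ (1 / 4 : ℝ), by positivity, by
      rw [← Real.rpow_natCast, ← Real.rpow_mul hc₀.le]; norm_num⟩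
  set l : ℝ := min 1 (c / (2 * C)) with hl
  have hl0 : 0 < l := lt_min one_pos (by positivity)
  have hl1 : l ≤ 1 := min_le_left _ _
  have hl2 : l * C ≤ c / 2 := by
    have : l ≤ c / (2 * C) := min_le_right _ _
    rw [le_div_iff₀ (by positivity)] at this
    linarith
  refine ⟨c / 2 * l ^ 3, by positivity, fun s hs hs2 hi => ?_⟩
  have hT := vert_pos s
  have hT1 : 1 ≤ vert s := by linarith [two_le_vert s]
  set u : ℝ := l ^ 4 * vert s ^ (-(5 * δ)) with hu
  have hu0 : 0 < u := by positivity
  have hu1 : u ≤ 1 := mul_le_one₀ (pow_le_one₀ hl0.le hl1) (by positivity)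
    (Real.rpow_le_one_of_one_le_of_nonpos hT1 (by linarith))
  have far : ∀ z : ℂ, 1 + u ≤ z.re → z.re ≤ 2 → z.im = s.im →
      c * l ^ 3 * vert s ^ (1 - 4 * δ) ≤ ‖riemannZeta₁ z‖ := by
    intro z hz hz2 hzi
    have hv : vert z = vert s := by unfold vert; rw [hzi]
    have h1 := h₀ z (by linarith) (by linarith) (by rwa [hzi])
    rw [hv] at h1
    refine le_of_pow_le_pow_left₀ (n := 4) (by norm_num) (norm_nonneg _) (le_trans ?_ h1)
    calc (c * l ^ 3 * vert s ^ (1 - 4 * δ)) ^ 4 = c ^ 4 * (u ^ 3 * vert s ^ (4 - δ)) := by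
          have e1 : (vert s ^ (1 - 4 * δ)) ^ 4 = vert s ^ (4 - 16 * δ) := by
            rw [← Real.rpow_natCast, ← Real.rpow_mul hT.le]; congr 1; push_cast; ring
          have e2 : (vert s ^ (-(5 * δ))) ^ 3 * vert s ^ (4 - δ) = vert s ^ (4 - 16 * δ) := by
            rw [← Real.rpow_natCast, ← Real.rpow_mul hT.le, ← Real.rpow_add hT]
            congr 1; push_cast; ring
          rw [mul_pow, e1, hu, ← e2]; ring
      _ ≤ c ^ 4 * ((z.re - 1) ^ 3 * vert s ^ (4 - δ)) := by
          gcongr; linarith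
  have hTd : 0 < vert s ^ (1 - 4 * δ) := Real.rpow_pos_of_pos hT _
  rcases le_total (1 + u) s.re with h1 | h1
  · refine le_trans ?_ (far s h1 hs2 rfl)
    gcongr
    linarith
  · set z : ℂ := ⟨1 + u, s.im⟩ with hz
    have h2 := far z le_rfl (by simp [hz]; linarith) rfl
    have hcv : Convex ℝ {w : ℂ | s.re ≤ w.re ∧ w.re ≤ 1 + u ∧ w.im = s.im} := by
      have := ((convex_halfSpace_re_ge s.re).inter (convex_halfSpace_re_le (1 + u))).inter
        ((convex_halfSpace_im_ge s.im).inter (convex_halfSpace_im_le s.im))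
      convert this using 1
      ext w
      simp only [mem_ofPred_eq, mem_inter_iff]
      constructor
      · rintro ⟨a, b, d⟩; exact ⟨⟨a, b⟩, d.ge, d.le⟩
      · rintro ⟨⟨a, b⟩, d, f⟩; exact ⟨a, b, le_antisymm f d⟩
    have h3 := hcv.norm_image_sub_le_of_norm_deriv_le (𝕜 := ℂ) (f := riemannZeta₁)
      (C := C * vert s ^ (1 + δ)) (x := s) (y := z)
      (fun w _ => differentiable_riemannZeta₁ w) (fun w hw => by
        have := hd w (by linarith [hw.1]) (by linarith [hw.2.1])
        rwa [show vert w = vert s by unfold vert; rw [hw.2.2]] at this)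
      ⟨le_rfl, h1, rfl⟩ ⟨h1, le_rfl, rfl⟩
    have h4 : ‖z - s‖ ≤ u := by
      refine (norm_le_abs_re_add_abs_im _).trans ?_
      simp only [hz, sub_re, sub_im, sub_self, abs_zero, add_zero]
      rw [abs_of_nonneg (by linarith)]; linarith
    have h5 : C * vert s ^ (1 + δ) * u = C * l * l ^ 3 * vert s ^ (1 - 4 * δ) := by
      have : vert s ^ (1 - 4 * δ) = vert s ^ (1 + δ) * vert s ^ (-(5 * δ)) := by
        rw [← Real.rpow_add hT]; congr 1; ring
      rw [this, hu]; ring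
    have h6 : ‖riemannZeta₁ z - riemannZeta₁ s‖ ≤ c / 2 * l ^ 3 * vert s ^ (1 - 4 * δ) := by
      refine h3.trans ?_
      calc _ ≤ C * vert s ^ (1 + δ) * u := by gcongr
        _ = C * l * l ^ 3 * vert s ^ (1 - 4 * δ) := h5
        _ ≤ _ := by gcongr; linarith
    have h7 := norm_sub_norm_le (riemannZeta₁ z) (riemannZeta₁ s)
    linarith

lemma isCompact_rect (a b c d : ℝ) : IsCompact (Icc a b ×ℂ Icc c d) :=
  isCompact_Icc.reProdIm isCompact_Icc

lemma exists_le_norm_riemannZeta₁ {δ : ℝ} (hδ : 0 < δ) (hδ1 : δ ≤ 1) :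
    ∃ c, 0 < c ∧ ∀ s : ℂ, 1 < s.re → s.re ≤ 2 →
      c * vert s ^ (1 - 4 * δ) ≤ ‖riemannZeta₁ s‖ := by
  obtain ⟨c, hc, h⟩ := exists_le_norm_riemannZeta₁_of_one_le_abs_im hδ hδ1
  obtain ⟨z, hz, hmin⟩ := (isCompact_rect 1 2 (-1) 1).exists_isMinOn
    (f := fun s => ‖riemannZeta₁ s‖)
    ⟨1, by simp [mem_reProdIm]⟩ differentiable_riemannZeta₁.continuous.norm.continuousOn
  have hm : 0 < ‖riemannZeta₁ z‖ := norm_pos_iff.2 (riemannZeta₁_ne_zero hz.1.1)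
  refine ⟨min c (‖riemannZeta₁ z‖ / 3), lt_min hc (by positivity), fun s hs hs2 => ?_⟩
  have hT := vert_pos s
  have hTd : 0 < vert s ^ (1 - 4 * δ) := Real.rpow_pos_of_pos hT _
  rcases le_total 1 |s.im| with hi | hi
  · refine le_trans ?_ (h s hs hs2 hi)
    gcongr
    exact min_le_left _ _
  · have h1 : ‖riemannZeta₁ z‖ ≤ ‖riemannZeta₁ s‖ :=
      hmin (show s ∈ Icc (1 : ℝ) 2 ×ℂ Icc (-1) 1 from ⟨⟨hs.le, hs2⟩, abs_le.1 hi⟩)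
    have h2 : vert s ^ (1 - 4 * δ) ≤ 3 := by
      calc vert s ^ (1 - 4 * δ) ≤ vert s ^ (1 : ℝ) :=
            Real.rpow_le_rpow_of_exponent_le (by linarith [two_le_vert s]) (by linarith)
        _ ≤ 3 := by rw [Real.rpow_one]; unfold vert; linarith
    calc _ ≤ ‖riemannZeta₁ z‖ / 3 * 3 := by gcongr; exact min_le_right _ _
      _ = ‖riemannZeta₁ z‖ := by ring
      _ ≤ _ := h1

lemma exists_norm_riemannZeta₀_le {δ : ℝ} (hδ : 0 < δ) (hδ1 : δ ≤ 1) :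
    ∃ C, 0 < C ∧ ∀ s : ℂ, 1 - δ / 4 ≤ s.re → s.re ≤ 4 →
      ‖riemannZeta₀ s‖ ≤ C * vert s ^ δ := by
  obtain ⟨C, hC, h⟩ := exists_norm_riemannZeta₁_le hδ hδ1
  obtain ⟨K, hK⟩ := (isCompact_rect 0 4 (-1) 1).exists_bound_of_continuousOn
    (f := riemannZeta₀) differentiable_riemannZeta₀.continuous.continuousOn
  have hK0 : 0 ≤ K := (norm_nonneg _).trans (hK 1 (by simp [mem_reProdIm]))
  refine ⟨3 * (C + 1) + K, by positivity, fun s hs hs4 => ?_⟩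
  have hT := vert_pos s
  have hT1 : 1 ≤ vert s := by linarith [two_le_vert s]
  have hTd : 1 ≤ vert s ^ δ := Real.one_le_rpow hT1 hδ.le
  rcases le_total 1 |s.im| with hi | hi
  · have h1 : |s.im| ≤ ‖s - 1‖ := by simpa using abs_im_le_norm (s - 1)
    have h2 := vert_le_three_mul hi
    have h3 : ‖s - 1‖ * ‖riemannZeta₀ s‖ ≤ C * vert s ^ (1 + δ) + 1 := by
      rw [← norm_mul, show (s - 1) * riemannZeta₀ s = riemannZeta₁ s - 1 by
        unfold riemannZeta₁; ring]
      refine (norm_sub_le _ _).trans ?_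
      rw [norm_one]
      linarith [h s hs hs4]
    have e : vert s ^ (1 + δ) = vert s * vert s ^ δ := by rw [Real.rpow_add hT, Real.rpow_one]
    have h4 : vert s * ‖riemannZeta₀ s‖ ≤ vert s * (3 * (C + 1) * vert s ^ δ) := by
      calc vert s * ‖riemannZeta₀ s‖ ≤ 3 * ‖s - 1‖ * ‖riemannZeta₀ s‖ := by gcongr; linarith
        _ ≤ 3 * (C * vert s ^ (1 + δ) + 1) := by linarith
        _ ≤ _ := by rw [e]; nlinarith
    have h5 := le_of_mul_le_mul_left h4 hT
    nlinarith
  · have := hK s ⟨⟨by linarith, hs4⟩, abs_le.1 hi⟩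
    nlinarith

/-- The analytic continuation of `ζ'/ζ + ζ` to a neighbourhood of the half-plane `1 ≤ re s`. -/
noncomputable def zetaLogDerivAdd (s : ℂ) : ℂ :=
  deriv riemannZeta₁ s / riemannZeta₁ s + riemannZeta₀ s

lemma exists_norm_zetaLogDerivAdd_le {δ : ℝ} (hδ : 0 < δ) (hδ1 : δ ≤ 1) :
    ∃ ρ, 0 < ρ ∧ ∃ C, 0 < C ∧ ∀ s : ℂ, 1 < s.re → s.re ≤ 2 →
      ∀ w ∈ closedBall s (ρ * vert s ^ (-(5 * δ))),
        riemannZeta₁ w ≠ 0 ∧ ‖zetaLogDerivAdd w‖ ≤ C * vert s ^ (5 * δ) := by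
  obtain ⟨c, hc, h⟩ := exists_le_norm_riemannZeta₁ hδ hδ1
  obtain ⟨C, hC, hd⟩ := exists_norm_deriv_riemannZeta₁_le hδ hδ1
  obtain ⟨K, hK, h₀⟩ := exists_norm_riemannZeta₀_le hδ hδ1
  set ρ : ℝ := min (δ / 8) (c / (8 * C)) with hρ
  have hρ0 : 0 < ρ := lt_min (by positivity) (by positivity)
  have hρ1 : ρ ≤ δ / 8 := min_le_left _ _
  have hρ2 : ρ * (4 * C) ≤ c / 2 := by
    have : ρ ≤ c / (8 * C) := min_le_right _ _
    rw [le_div_iff₀ (by positivity)] at this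
    linarith
  refine ⟨ρ, hρ0, 8 * C / c + 2 * K, by positivity, fun s hs hs2 w hw => ?_⟩
  have hT := vert_pos s
  have hT1 : 1 ≤ vert s := by linarith [two_le_vert s]
  have hr : ρ * vert s ^ (-(5 * δ)) ≤ ρ := mul_le_of_le_one_right hρ0.le
    (Real.rpow_le_one_of_one_le_of_nonpos hT1 (by linarith))
  have hball : ∀ z ∈ closedBall s (ρ * vert s ^ (-(5 * δ))),
      1 - δ / 8 ≤ z.re ∧ z.re ≤ 7 / 2 ∧ vert z ≤ 2 * vert s := by
    intro z hz
    have h1 : ‖z - s‖ ≤ ρ := (by simpa [dist_eq_norm] using hz : ‖z - s‖ ≤ _).trans hr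
    have h2 : |z.re - s.re| ≤ ‖z - s‖ := by simpa using abs_re_le_norm (z - s)
    have h3 := abs_le.1 (h2.trans h1)
    exact ⟨by linarith, by linarith, vert_le_two_mul (by linarith)⟩
  have two_rpow : (2 : ℝ) ^ (1 + δ) ≤ 4 := by
    calc (2 : ℝ) ^ (1 + δ) ≤ 2 ^ (2 : ℝ) :=
          Real.rpow_le_rpow_of_exponent_le (by norm_num) (by linarith)
      _ = 4 := by norm_num
  have hder : ∀ z ∈ closedBall s (ρ * vert s ^ (-(5 * δ))),
      ‖deriv riemannZeta₁ z‖ ≤ 4 * C * vert s ^ (1 + δ) := by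
    intro z hz
    obtain ⟨a, b, d⟩ := hball z hz
    have hz0 := vert_pos z
    calc ‖deriv riemannZeta₁ z‖ ≤ C * vert z ^ (1 + δ) := hd z a b
      _ ≤ C * (2 * vert s) ^ (1 + δ) := by gcongr
      _ = C * (2 ^ (1 + δ) * vert s ^ (1 + δ)) := by rw [Real.mul_rpow (by norm_num) hT.le]
      _ ≤ C * (4 * vert s ^ (1 + δ)) := by gcongr
      _ = _ := by ring
  have e1 : vert s ^ (1 + δ) = vert s ^ (1 - 4 * δ) * vert s ^ (5 * δ) := by
    rw [← Real.rpow_add hT]; congr 1; ring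
  have e2 : vert s ^ (5 * δ) * vert s ^ (-(5 * δ)) = 1 := by
    rw [← Real.rpow_add hT]; simp
  have hA : 0 < vert s ^ (1 - 4 * δ) := Real.rpow_pos_of_pos hT _
  have hB : 0 < vert s ^ (5 * δ) := Real.rpow_pos_of_pos hT _
  have hB' : 0 < vert s ^ (-(5 * δ)) := Real.rpow_pos_of_pos hT _
  have hsub := (convex_closedBall s (ρ * vert s ^ (-(5 * δ)))).norm_image_sub_le_of_norm_deriv_le
    (𝕜 := ℂ) (fun z _ => differentiable_riemannZeta₁ z) hder hw
    (mem_closedBall_self (by positivity))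
  have hws : ‖s - w‖ ≤ ρ * vert s ^ (-(5 * δ)) := by
    rw [norm_sub_rev]; simpa [dist_eq_norm] using hw
  have hlow : c / 2 * vert s ^ (1 - 4 * δ) ≤ ‖riemannZeta₁ w‖ := by
    have h1 := h s hs hs2
    have h2 : ‖riemannZeta₁ s - riemannZeta₁ w‖ ≤ c / 2 * vert s ^ (1 - 4 * δ) := by
      calc _ ≤ 4 * C * vert s ^ (1 + δ) * ‖s - w‖ := hsub
        _ ≤ 4 * C * vert s ^ (1 + δ) * (ρ * vert s ^ (-(5 * δ))) := by gcongr
        _ = ρ * (4 * C) * vert s ^ (1 - 4 * δ) * (vert s ^ (5 * δ) * vert s ^ (-(5 * δ))) := by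
            rw [e1]; ring
        _ ≤ c / 2 * vert s ^ (1 - 4 * δ) := by rw [e2, mul_one]; gcongr
    have h3 := norm_sub_norm_le (riemannZeta₁ s) (riemannZeta₁ w)
    linarith
  have hpos : 0 < ‖riemannZeta₁ w‖ := lt_of_lt_of_le (by positivity) hlow
  refine ⟨norm_pos_iff.1 hpos, ?_⟩
  obtain ⟨a, b, d⟩ := hball w hw
  have b1 : ‖deriv riemannZeta₁ w / riemannZeta₁ w‖ ≤ 8 * C / c * vert s ^ (5 * δ) := by
    rw [norm_div, div_le_iff₀ hpos]
    calc _ ≤ 4 * C * vert s ^ (1 + δ) := hder w hw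
      _ = 8 * C / c * vert s ^ (5 * δ) * (c / 2 * vert s ^ (1 - 4 * δ)) := by
          rw [e1]; field_simp; norm_num
      _ ≤ _ := by gcongr
  have b2 : ‖riemannZeta₀ w‖ ≤ 2 * K * vert s ^ (5 * δ) := by
    have hw0 := vert_pos w
    calc ‖riemannZeta₀ w‖ ≤ K * vert w ^ δ := h₀ w (by linarith) (by linarith)
      _ ≤ K * (2 * vert s) ^ δ := by gcongr
      _ = K * (2 ^ δ * vert s ^ δ) := by rw [Real.mul_rpow (by norm_num) hT.le]
      _ ≤ K * (2 * vert s ^ (5 * δ)) := by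
          gcongr
          · calc (2 : ℝ) ^ δ ≤ 2 ^ (1 : ℝ) := Real.rpow_le_rpow_of_exponent_le (by norm_num) hδ1
              _ = 2 := Real.rpow_one _
          · linarith
      _ = _ := by ring
  calc _ ≤ _ := norm_add_le _ _
    _ ≤ _ := by rw [add_mul]; exact add_le_add b1 b2

lemma differentiableAt_zetaLogDerivAdd {s : ℂ} (hs : riemannZeta₁ s ≠ 0) :
    DifferentiableAt ℂ zetaLogDerivAdd s :=
  ((differentiable_riemannZeta₁.deriv s).div (differentiable_riemannZeta₁ s) hs).add
    (differentiable_riemannZeta₀ s)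

theorem exists_norm_iteratedDeriv_zetaLogDerivAdd_le (k : ℕ) :
    ∃ C, 0 < C ∧ ∀ s : ℂ, 1 < s.re → s.re ≤ 2 →
      ‖iteratedDeriv k zetaLogDerivAdd s‖ ≤ C * vert s ^ (1 / 2 : ℝ) := by
  set δ : ℝ := 1 / (10 * (k + 1)) with hδ
  have hk : (0 : ℝ) < 10 * (k + 1) := by positivity
  have hδ0 : 0 < δ := by positivity
  have hδ1 : δ ≤ 1 := by
    rw [hδ, div_le_one hk]; linarith [(Nat.cast_nonneg k : (0 : ℝ) ≤ k)]
  obtain ⟨ρ, hρ, C, hC, h⟩ := exists_norm_zetaLogDerivAdd_le hδ0 hδ1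
  refine ⟨k.factorial * C / ρ ^ k, by positivity, fun s hs hs2 => ?_⟩
  have hT := vert_pos s
  have hB' : 0 < vert s ^ (-(5 * δ)) := Real.rpow_pos_of_pos hT _
  have hdc : DiffContOnCl ℂ zetaLogDerivAdd (ball s (ρ * vert s ^ (-(5 * δ)))) := by
    refine DifferentiableOn.diffContOnCl_ball (U := closedBall s (ρ * vert s ^ (-(5 * δ))))
      (fun w hw => ?_) subset_rfl
    exact (differentiableAt_zetaLogDerivAdd (h s hs hs2 w hw).1).differentiableWithinAt
  refine (norm_iteratedDeriv_le_of_forall_mem_sphere_norm_le k (by positivity) hdc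
    fun w hw => (h s hs hs2 w (sphere_subset_closedBall hw)).2).trans (le_of_eq ?_)
  have e1 : vert s ^ (5 * δ) = vert s ^ (1 / 2 : ℝ) * (vert s ^ (-(5 * δ))) ^ k := by
    rw [← Real.rpow_natCast, ← Real.rpow_mul hT.le, ← Real.rpow_add hT]
    congr 1
    rw [hδ]; field_simp; ring
  rw [e1, mul_pow]
  field_simp

end ZetaLowerBound

section Perron

open Topology Complex Set MeasureTheory

/-- The Riesz weight `max (1 - t) 0`, as a complex-valued function on the positive reals. -/
noncomputable def rieszWeight (t : ℝ) : ℂ :=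
  (Ioc 0 1).indicator (fun _ => (1 : ℂ)) t - (Ioc 0 1).indicator (fun t : ℝ => (t : ℂ) ^ (1 : ℂ)) t

lemma rieszWeight_of_pos {t : ℝ} (ht : 0 < t) : rieszWeight t = ((max (1 - t) 0 : ℝ) : ℂ) := by
  unfold rieszWeight
  rcases le_total t 1 with h | h
  · have hmem : t ∈ Ioc (0 : ℝ) 1 := ⟨ht, h⟩
    rw [indicator_of_mem hmem, indicator_of_mem hmem, max_eq_left (by linarith)]
    simp
  · rcases h.eq_or_lt with rfl | h
    · simp
    · have : t ∉ Ioc (0 : ℝ) 1 := fun h' => absurd h'.2 (not_le.2 h)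
      rw [indicator_of_notMem this, indicator_of_notMem this, max_eq_right (by linarith)]
      simp

lemma continuousAt_rieszWeight {t : ℝ} (ht : 0 < t) : ContinuousAt rieszWeight t := by
  have h : ContinuousAt (fun t : ℝ => ((max (1 - t) 0 : ℝ) : ℂ)) t := by fun_prop
  refine h.congr ?_
  filter_upwards [lt_mem_nhds ht] with x hx
  exact (rieszWeight_of_pos hx).symm

lemma hasMellin_rieszWeight {s : ℂ} (hs : 0 < s.re) :
    HasMellin rieszWeight s (1 / s - 1 / (s + 1)) := by
  have h1 := hasMellin_one_Ioc hs
  have h2 := hasMellin_cpow_Ioc 1 (s := s) (by simp; linarith)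
  have h3 := hasMellin_sub h1.1 h2.1
  rw [h1.2, h2.2] at h3
  exact h3

/-- The Mellin transform of the Riesz weight on the line `re s = σ`. -/
noncomputable def rieszKernel (σ t : ℝ) : ℂ :=
  1 / (σ + t * I) - 1 / (σ + t * I + 1)

lemma norm_rieszKernel_le {σ : ℝ} (hσ : 1 ≤ σ) (t : ℝ) : ‖rieszKernel σ t‖ ≤ (1 + t ^ 2)⁻¹ := by
  have h0 : (σ + t * I : ℂ) ≠ 0 := fun h => by
    have := congrArg re h; simp at this; linarith
  have h1 : (σ + t * I + 1 : ℂ) ≠ 0 := fun h => by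
    have := congrArg re h; simp at this; linarith
  have e : rieszKernel σ t = ((σ + t * I) * (σ + t * I + 1))⁻¹ := by
    unfold rieszKernel; field_simp; ring
  have n1 : ‖(σ + t * I : ℂ)‖ = √(σ ^ 2 + t ^ 2) := norm_add_mul_I _ _
  have n2 : ‖(σ + t * I + 1 : ℂ)‖ = √((σ + 1) ^ 2 + t ^ 2) := by
    rw [← norm_add_mul_I]; congr 1; push_cast; ring
  rw [e, norm_inv, norm_mul, n1, n2]
  refine inv_anti₀ (by positivity) ?_
  rw [← Real.sqrt_mul (by positivity)]
  refine Real.le_sqrt_of_sq_le ?_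
  have a1 : 1 + t ^ 2 ≤ σ ^ 2 + t ^ 2 := by nlinarith
  have a2 : 1 + t ^ 2 ≤ (σ + 1) ^ 2 + t ^ 2 := by nlinarith
  rw [sq]
  gcongr

lemma continuous_rieszKernel {σ : ℝ} (hσ : 1 ≤ σ) : Continuous (rieszKernel σ) := by
  unfold rieszKernel
  refine Continuous.sub (Continuous.div (by fun_prop) (by fun_prop) fun t h => ?_)
    (Continuous.div (by fun_prop) (by fun_prop) fun t h => ?_)
  all_goals have := congrArg re h; simp at this; linarith

lemma integrable_rieszKernel {σ : ℝ} (hσ : 1 ≤ σ) : Integrable (rieszKernel σ) :=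
  integrable_inv_one_add_sq.mono' (continuous_rieszKernel hσ).aestronglyMeasurable
    (ae_of_all _ (norm_rieszKernel_le hσ))

lemma rieszWeight_eq_integral {σ : ℝ} (hσ : 1 ≤ σ) {x : ℝ} (hx : 0 < x) :
    rieszWeight x = (1 / (2 * Real.pi)) • ∫ t : ℝ, (x : ℂ) ^ (-(σ + t * I)) • rieszKernel σ t := by
  have hm : ∀ t : ℝ, mellin rieszWeight (σ + t * I) = rieszKernel σ t := fun t =>
    (hasMellin_rieszWeight (by simp; linarith)).2
  have h := mellinInv_mellin_eq σ rieszWeight hx (hasMellin_rieszWeight (by simp; linarith)).1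
    (by
      unfold VerticalIntegrable
      simp_rw [hm]
      exact integrable_rieszKernel hσ) (continuousAt_rieszWeight hx)
  rw [← h, mellinInv]
  simp_rw [hm]

lemma norm_riesz_mean_le {a : ℕ → ℂ} {σ : ℝ} (hσ : 1 ≤ σ) (ha : LSeriesSummable a σ)
    (ha0 : a 0 = 0) {x : ℝ} (hx : 0 < x) {B : ℝ → ℝ} (hB : Integrable B)
    (hL : ∀ t : ℝ, ‖LSeries a (σ + t * I)‖ * (1 + t ^ 2)⁻¹ ≤ B t) :
    ‖∑ n ∈ Finset.Icc 0 ⌊x⌋₊, a n * ((1 - n / x : ℝ) : ℂ)‖ ≤ x ^ σ * ∫ t, B t := by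
  set W : ℝ → ℂ := fun t => (x : ℂ) ^ (σ + t * I : ℂ) * rieszKernel σ t with hW
  have hx0 : (x : ℂ) ≠ 0 := by exact_mod_cast hx.ne'
  have hnx : ∀ t : ℝ, ‖(x : ℂ) ^ (σ + t * I : ℂ)‖ = x ^ σ := fun t => by
    rw [norm_cpow_eq_rpow_re_of_pos hx]; simp
  have hWc : Continuous W := by
    refine Continuous.mul ?_ (continuous_rieszKernel hσ)
    exact Continuous.const_cpow (by fun_prop) (Or.inl hx0)
  have hWn : ∀ t, ‖W t‖ = x ^ σ * ‖rieszKernel σ t‖ := fun t => by rw [hW]; simp [hnx]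
  have hWi : Integrable W :=
    ((integrable_rieszKernel hσ).norm.const_mul (x ^ σ)).mono' hWc.aestronglyMeasurable
      (ae_of_all _ fun t => (hWn t).le)
  set F : ℕ → ℝ → ℂ := fun n t => LSeries.term a (σ + t * I) n * W t with hF
  have hterm : ∀ (n : ℕ) (t : ℝ), ‖LSeries.term a (σ + t * I) n‖ = ‖LSeries.term a σ n‖ := by
    intro n t; simp [LSeries.norm_term_eq]
  have htc : ∀ n : ℕ, Continuous fun t : ℝ => LSeries.term a (σ + t * I) n := by
    intro n
    simp only [LSeries.term_def]
    split_ifs with hn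
    · exact continuous_const
    · have hn' : (n : ℂ) ≠ 0 := by exact_mod_cast hn
      refine Continuous.div continuous_const
        (Continuous.const_cpow (by fun_prop) (Or.inl hn')) fun t => ?_
      simp [cpow_eq_zero_iff, hn]
  have hFn : ∀ n t, ‖F n t‖ = ‖LSeries.term a σ n‖ * ‖W t‖ := fun n t => by
    rw [hF]; simp only [norm_mul, hterm]
  have hFi : ∀ n, Integrable (F n) := fun n =>
    (hWi.norm.const_mul ‖LSeries.term a σ n‖).mono' ((htc n).mul hWc).aestronglyMeasurable
      (ae_of_all _ fun t => (hFn n t).le)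
  have hFs : Summable fun n => ∫ t, ‖F n t‖ := by
    simp_rw [hFn, integral_const_mul]
    exact ha.norm.mul_right _
  have key := integral_tsum_of_summable_integral_norm hFi hFs
  have hint : ∀ n : ℕ, ∫ t, F n t = (2 * Real.pi) • (a n * rieszWeight (n / x)) := by
    intro n
    rcases eq_or_ne n 0 with rfl | hn
    · simp [hF, ha0]
    have hn0 : (0 : ℝ) < n := by exact_mod_cast Nat.pos_of_ne_zero hn
    have hnc : (n : ℂ) ≠ 0 := by exact_mod_cast hn
    rw [rieszWeight_eq_integral hσ (div_pos hn0 hx), mul_smul_comm, smul_smul,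
      mul_one_div_cancel (by positivity), one_smul, ← integral_const_mul]
    refine integral_congr_ae (ae_of_all _ fun t => ?_)
    simp only [hF, hW, LSeries.term_of_ne_zero hn, smul_eq_mul]
    rw [show ((n / x : ℝ) : ℂ) = ((n : ℝ) : ℂ) * ((x⁻¹ : ℝ) : ℂ) by push_cast; ring,
      mul_cpow_ofReal_nonneg hn0.le (by positivity), ofReal_inv,
      inv_cpow _ _ (by rw [arg_ofReal_of_nonneg hx.le]; exact Real.pi_pos.ne), cpow_neg, cpow_neg,
      inv_inv]
    push_cast
    ring
  have hfin : ∑' n, ∫ t, F n t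
      = (2 * Real.pi) • ∑ n ∈ Finset.Icc 0 ⌊x⌋₊, a n * ((1 - n / x : ℝ) : ℂ) := by
    rw [tsum_eq_sum (s := Finset.Icc 0 ⌊x⌋₊), Finset.smul_sum]
    · refine Finset.sum_congr rfl fun n hn => ?_
      rw [hint]
      rcases eq_or_ne n 0 with rfl | hn0
      · simp [ha0]
      have hn1 : (0 : ℝ) < n := by exact_mod_cast Nat.pos_of_ne_zero hn0
      have hnx : (n : ℝ) ≤ x := (Nat.le_floor_iff hx.le).1 (Finset.mem_Icc.1 hn).2
      rw [rieszWeight_of_pos (div_pos hn1 hx), max_eq_left]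
      rw [sub_nonneg, div_le_one hx]; exact hnx
    · intro n hn
      have hn2 : x < n := by
        by_contra h
        exact hn (Finset.mem_Icc.2 ⟨Nat.zero_le _, Nat.le_floor (not_lt.1 h)⟩)
      rw [hint, rieszWeight_of_pos (div_pos (hx.trans hn2) hx), max_eq_right]
      · simp
      · rw [sub_nonpos, one_le_div hx]; exact hn2.le
  rw [hfin] at key
  have hsum : ∀ t : ℝ, ∑' n, F n t = LSeries a (σ + t * I) * W t := fun t => tsum_mul_right
  simp_rw [hsum] at key
  have hb : ‖∫ t : ℝ, LSeries a (σ + t * I) * W t‖ ≤ x ^ σ * ∫ t, B t := by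
    rw [← integral_const_mul]
    refine norm_integral_le_of_norm_le (hB.const_mul _) (ae_of_all _ fun t => ?_)
    rw [norm_mul, hWn]
    have h1 := norm_rieszKernel_le hσ t
    calc _ = x ^ σ * (‖LSeries a (σ + t * I)‖ * ‖rieszKernel σ t‖) := by ring
      _ ≤ x ^ σ * (‖LSeries a (σ + t * I)‖ * (1 + t ^ 2)⁻¹) := by gcongr
      _ ≤ _ := by gcongr; exact hL t
  rw [← key, norm_smul, Real.norm_of_nonneg (by positivity)] at hb
  refine le_trans (le_mul_of_one_le_left (norm_nonneg _) ?_) hb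
  linarith [Real.pi_gt_three]

end Perron

section VonMangoldtRiesz

open Topology Complex Set MeasureTheory

/-- `(1 - Λ(n)) log^k n` for `n ≥ 1`, and `0` for `n = 0`. -/
noncomputable def logWeighted (k n : ℕ) : ℝ :=
  if n = 0 then 0 else Real.log n ^ k * (1 - ArithmeticFunction.vonMangoldt n)

lemma abscissaOfAbsConv_one_sub_vonMangoldt_le :
    LSeries.abscissaOfAbsConv (fun n => 1 - (ArithmeticFunction.vonMangoldt n : ℂ)) ≤ (1 : ℝ) :=
  LSeries.abscissaOfAbsConv_le_of_forall_lt_LSeriesSummable fun y hy =>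
    (LSeriesSummable_one_iff.2 (by simpa using hy)).sub
      (ArithmeticFunction.LSeriesSummable_vonMangoldt (by simpa using hy))

lemma LSeries_one_sub_vonMangoldt {s : ℂ} (hs : 1 < s.re) :
    LSeries (fun n => 1 - (ArithmeticFunction.vonMangoldt n : ℂ)) s = zetaLogDerivAdd s := by
  have h1 := LSeries_sub (LSeriesSummable_one_iff.2 hs)
    (ArithmeticFunction.LSeriesSummable_vonMangoldt hs)
  have hs1 : s ≠ 1 := fun h => by simp [h] at hs
  have h0 : s - 1 ≠ 0 := sub_ne_zero.2 hs1
  have h2 := riemannZeta₁_ne_zero hs.le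
  refine h1.trans ?_
  rw [LSeries_one_eq_riemannZeta hs,
    ArithmeticFunction.LSeries_vonMangoldt_eq_deriv_riemannZeta_div hs, zetaLogDerivAdd,
    deriv_riemannZeta_eq_neg_inv_sub_sq_mul_add hs1]
  have h3 : riemannZeta₀ s = riemannZeta s - (s - 1)⁻¹ := by
    rw [riemannZeta_eq_inv_sub_add hs1]; ring
  rw [h3, riemannZeta_eq_inv_sub_mul hs1]
  field_simp
  ring

lemma logMul_iterate (f : ℕ → ℂ) (k n : ℕ) :
    LSeries.logMul^[k] f n = Complex.log n ^ k * f n := by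
  induction k with
  | zero => simp
  | succ k ih => rw [Function.iterate_succ_apply', LSeries.logMul, ih, pow_succ]; ring

lemma LSeriesSummable_logMul_iterate_one_sub_vonMangoldt (k : ℕ) {s : ℂ} (hs : 1 < s.re) :
    LSeriesSummable (LSeries.logMul^[k] fun n => 1 - (ArithmeticFunction.vonMangoldt n : ℂ)) s := by
  refine LSeriesSummable_of_abscissaOfAbsConv_lt_re ?_
  rw [LSeries.absicssaOfAbsConv_logPowMul]
  exact abscissaOfAbsConv_one_sub_vonMangoldt_le.trans_lt (by exact_mod_cast hs)

lemma ofReal_logWeighted {k n : ℕ} (hn : n ≠ 0) : (logWeighted k n : ℂ)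
    = LSeries.logMul^[k] (fun n => 1 - (ArithmeticFunction.vonMangoldt n : ℂ)) n := by
  rw [logMul_iterate, logWeighted, if_neg hn]
  push_cast
  rfl

lemma exists_norm_LSeries_logWeighted_le (k : ℕ) :
    ∃ C, 0 < C ∧ ∀ s : ℂ, 1 < s.re → s.re ≤ 2 →
      ‖LSeries (fun n => (logWeighted k n : ℂ)) s‖ ≤ C * vert s ^ (1 / 2 : ℝ) := by
  obtain ⟨C, hC, h⟩ := exists_norm_iteratedDeriv_zetaLogDerivAdd_le k
  refine ⟨C, hC, fun s hs hs2 => ?_⟩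
  have h1 := LSeries_iteratedDeriv (f := fun n => 1 - (ArithmeticFunction.vonMangoldt n : ℂ)) k
    (s := s) (abscissaOfAbsConv_one_sub_vonMangoldt_le.trans_lt (by exact_mod_cast hs))
  have h2 : iteratedDeriv k (LSeries fun n => 1 - (ArithmeticFunction.vonMangoldt n : ℂ)) s
      = iteratedDeriv k zetaLogDerivAdd s := by
    refine Filter.EventuallyEq.iteratedDeriv_eq k ?_
    filter_upwards [(isOpen_lt continuous_const continuous_re).mem_nhds
      (show s ∈ {s : ℂ | 1 < s.re} from hs)] with w hw
    exact LSeries_one_sub_vonMangoldt hw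
  have h3 : LSeries (fun n => (logWeighted k n : ℂ)) s
      = LSeries (LSeries.logMul^[k] fun n => 1 - (ArithmeticFunction.vonMangoldt n : ℂ)) s :=
    LSeries_congr (fun hn => ofReal_logWeighted hn) s
  have h4 := h s hs hs2
  rwa [← h2, h1, norm_mul, norm_pow, norm_neg, norm_one, one_pow, one_mul, ← h3] at h4

lemma integrable_sqrt_vert_mul : Integrable fun t : ℝ => 2 * (1 + ‖t‖ ^ 2) ^ (-(3 / 2 : ℝ) / 2) :=
  (integrable_rpow_neg_one_add_norm_sq (by simp; norm_num)).const_mul 2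

lemma sqrt_add_abs_mul_le (t : ℝ) :
    (2 + |t|) ^ (1 / 2 : ℝ) * (1 + t ^ 2)⁻¹ ≤ 2 * (1 + ‖t‖ ^ 2) ^ (-(3 / 2 : ℝ) / 2) := by
  have h0 : 0 < 1 + t ^ 2 := by positivity
  have h1 : (2 + |t|) ^ (1 / 2 : ℝ) ≤ 2 * (1 + t ^ 2) ^ (1 / 4 : ℝ) := by
    have e : 2 * (1 + t ^ 2) ^ (1 / 4 : ℝ) = (16 * (1 + t ^ 2)) ^ (1 / 4 : ℝ) := by
      rw [Real.mul_rpow (by norm_num) h0.le, show (16 : ℝ) = 2 ^ (4 : ℝ) by norm_num,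
        ← Real.rpow_mul (by norm_num)]
      norm_num
    have e2 : (2 + |t|) ^ (1 / 2 : ℝ) = ((2 + |t|) ^ 2) ^ (1 / 4 : ℝ) := by
      rw [← Real.rpow_natCast, ← Real.rpow_mul (by positivity)]; norm_num
    rw [e, e2]
    refine Real.rpow_le_rpow (by positivity) ?_ (by norm_num)
    nlinarith [sq_abs t, sq_nonneg (|t| - 1), abs_nonneg t]
  have e3 : (1 + ‖t‖ ^ 2) ^ (-(3 / 2 : ℝ) / 2) = (1 + t ^ 2) ^ (1 / 4 : ℝ) * (1 + t ^ 2)⁻¹ := by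
    rw [Real.norm_eq_abs, sq_abs, ← Real.rpow_neg_one, ← Real.rpow_add h0]; norm_num
  rw [e3, ← mul_assoc]
  gcongr

theorem exists_abs_riesz_mean_logWeighted_le (k : ℕ) :
    ∃ C, 0 < C ∧ ∀ x : ℝ, 3 ≤ x →
      |∑ n ∈ Finset.Icc 0 ⌊x⌋₊, logWeighted k n * (x - n)| ≤ C * x ^ 2 := by
  obtain ⟨C, hC, h⟩ := exists_norm_LSeries_logWeighted_le k
  set J := ∫ t : ℝ, 2 * (1 + ‖t‖ ^ 2) ^ (-(3 / 2 : ℝ) / 2) with hJ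
  have hJ0 : 0 ≤ J := integral_nonneg fun t => by positivity
  refine ⟨Real.exp 1 * (C * J) + 1, by positivity, fun x hx => ?_⟩
  have hx0 : 0 < x := by linarith
  have hlog : 1 ≤ Real.log x := by
    rw [Real.le_log_iff_exp_le hx0]; linarith [Real.exp_one_lt_three]
  set σ : ℝ := 1 + 1 / Real.log x with hσ
  have hσ1 : 1 < σ := by rw [hσ]; have : 0 < 1 / Real.log x := by positivity
                         linarith
  have hσ2 : σ ≤ 2 := by
    have : 1 / Real.log x ≤ 1 := by rw [div_le_one (by linarith)]; exact hlog
    linarith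
  have hs : LSeriesSummable (fun n => (logWeighted k n : ℂ)) σ :=
    (LSeriesSummable_congr _ fun hn => ofReal_logWeighted hn).2
      (LSeriesSummable_logMul_iterate_one_sub_vonMangoldt k (by simpa using hσ1))
  have key := norm_riesz_mean_le hσ1.le hs (by simp [logWeighted]) hx0
    (integrable_sqrt_vert_mul.const_mul C) (fun t => by
      have h1 := h (σ + t * I) (by simpa using hσ1) (by simpa using hσ2)
      have h2 : vert (σ + t * I) = 2 + |t| := by simp [vert]
      rw [h2] at h1
      calc _ ≤ C * (2 + |t|) ^ (1 / 2 : ℝ) * (1 + t ^ 2)⁻¹ := by gcongr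
        _ ≤ _ := by
          rw [mul_assoc]
          exact mul_le_mul_of_nonneg_left (sqrt_add_abs_mul_le t) hC.le)
  rw [integral_const_mul, ← hJ] at key
  have hxs : x ^ σ = Real.exp 1 * x := by
    rw [hσ, Real.rpow_add hx0, Real.rpow_one, Real.rpow_def_of_pos hx0,
      mul_one_div_cancel (by linarith)]
    ring
  rw [hxs] at key
  have e : ∑ n ∈ Finset.Icc 0 ⌊x⌋₊, (logWeighted k n : ℂ) * ((1 - n / x : ℝ) : ℂ)
      = ((∑ n ∈ Finset.Icc 0 ⌊x⌋₊, logWeighted k n * (1 - n / x) : ℝ) : ℂ) := by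
    push_cast; rfl
  rw [e, norm_real, Real.norm_eq_abs] at key
  have e2 : ∑ n ∈ Finset.Icc 0 ⌊x⌋₊, logWeighted k n * (x - n)
      = x * ∑ n ∈ Finset.Icc 0 ⌊x⌋₊, logWeighted k n * (1 - n / x) := by
    rw [Finset.mul_sum]
    refine Finset.sum_congr rfl fun n _ => ?_
    field_simp
  rw [e2, abs_mul, abs_of_pos hx0]
  calc _ ≤ x * (Real.exp 1 * x * (C * J)) := by gcongr
    _ ≤ _ := by nlinarith [sq_nonneg x]

end VonMangoldtRiesz

section Unsmoothing

open Asymptotics Real MeasureTheory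

lemma abs_logWeighted_le (k : ℕ) {n : ℕ} {y : ℝ} (hn : 1 ≤ n) (hny : (n : ℝ) ≤ y) :
    |logWeighted k n| ≤ log y ^ k * (1 + log y) := by
  have h1 : (1 : ℝ) ≤ n := by exact_mod_cast hn
  have hl : log n ≤ log y := log_le_log (by linarith) hny
  have hl0 : 0 ≤ log (n : ℝ) := log_nonneg h1
  have h2 : ArithmeticFunction.vonMangoldt n ≤ log n := ArithmeticFunction.vonMangoldt_le_log
  have h3 : 0 ≤ ArithmeticFunction.vonMangoldt n := ArithmeticFunction.vonMangoldt_nonneg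
  rw [logWeighted, if_neg (by omega), abs_mul, abs_of_nonneg (pow_nonneg hl0 k)]
  refine mul_le_mul (pow_le_pow_left₀ hl0 hl k) ?_ (abs_nonneg _)
    (pow_nonneg (hl0.trans hl) k)
  rw [abs_le]
  constructor <;> linarith

lemma riesz_mean_sub_eq (a : ℕ → ℝ) {x y : ℝ} (hxy : x ≤ y) :
    ∑ n ∈ Finset.Icc 0 ⌊y⌋₊, a n * (y - n) - ∑ n ∈ Finset.Icc 0 ⌊x⌋₊, a n * (x - n) =
      (y - x) * ∑ n ∈ Finset.Icc 0 ⌊x⌋₊, a n + ∑ n ∈ Finset.Ioc ⌊x⌋₊ ⌊y⌋₊, a n * (y - n) := by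
  have hsplit : ∑ n ∈ Finset.Icc 0 ⌊y⌋₊, a n * (y - n) =
      ∑ n ∈ Finset.Icc 0 ⌊x⌋₊, a n * (y - n) + ∑ n ∈ Finset.Ioc ⌊x⌋₊ ⌊y⌋₊, a n * (y - n) := by
    rw [← Finset.sum_union]
    · congr 1
      ext n
      have := Nat.floor_mono hxy
      simp only [Finset.mem_union, Finset.mem_Icc, Finset.mem_Ioc]
      omega
    · rw [Finset.disjoint_left]
      intro n h1 h2
      simp only [Finset.mem_Icc, Finset.mem_Ioc] at h1 h2
      omega
  rw [hsplit, Finset.mul_sum, add_sub_right_comm, ← Finset.sum_sub_distrib]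
  congr 1
  exact Finset.sum_congr rfl fun n _ => by ring

lemma mul_abs_sum_logWeighted_le (k : ℕ) {C x h : ℝ} (hx : 3 ≤ x) (hh : 0 ≤ h) (hhx : h ≤ x)
    (hC : ∀ y, 3 ≤ y → |∑ n ∈ Finset.Icc 0 ⌊y⌋₊, logWeighted k n * (y - n)| ≤ C * y ^ 2) :
    h * |∑ n ∈ Finset.Icc 0 ⌊x⌋₊, logWeighted k n| ≤
      5 * C * x ^ 2 + h * ((h + 1) * ((2 * log x) ^ k * (1 + 2 * log x))) := by
  have hlog : log (x + h) ≤ 2 * log x := by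
    have h1 : log (x + h) ≤ log (x ^ 2) := log_le_log (by linarith) (by nlinarith)
    rwa [log_pow, Nat.cast_ofNat] at h1
  have hlog0 : 0 ≤ log (x + h) := log_nonneg (by linarith)
  have hlogx : 0 ≤ log x := log_nonneg (by linarith)
  have hC0 : 0 ≤ C := by
    have := (abs_nonneg _).trans (hC 3 le_rfl)
    linarith
  have hE : |∑ n ∈ Finset.Ioc ⌊x⌋₊ ⌊x + h⌋₊, logWeighted k n * (x + h - n)| ≤
      h * ((h + 1) * ((2 * log x) ^ k * (1 + 2 * log x))) := by
    have hterm : ∀ n ∈ Finset.Ioc ⌊x⌋₊ ⌊x + h⌋₊, |logWeighted k n * (x + h - n)| ≤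
        (2 * log x) ^ k * (1 + 2 * log x) * h := by
      intro n hn
      rw [Finset.mem_Ioc] at hn
      have h1 : x < n := (Nat.floor_lt (by linarith)).1 hn.1
      have h2 : (n : ℝ) ≤ x + h := (Nat.le_floor_iff (by linarith)).1 hn.2
      rw [abs_mul, abs_of_nonneg (by linarith : 0 ≤ x + h - n)]
      refine mul_le_mul ((abs_logWeighted_le k (by omega) h2).trans ?_) (by linarith)
        (by linarith) (by positivity)
      gcongr
    refine (Finset.abs_sum_le_sum_abs _ _).trans ((Finset.sum_le_card_nsmul _ _ _ hterm).trans ?_)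
    rw [Nat.card_Ioc, nsmul_eq_mul, Nat.cast_sub (Nat.floor_mono (by linarith))]
    have h1 : (⌊x + h⌋₊ : ℝ) ≤ x + h := Nat.floor_le (by linarith)
    have h2 : x < ⌊x⌋₊ + 1 := Nat.lt_floor_add_one x
    have h3 : 0 ≤ (2 * log x) ^ k * (1 + 2 * log x) * h := by positivity
    nlinarith
  have hkey := riesz_mean_sub_eq (logWeighted k) (by linarith : x ≤ x + h)
  have hC1 := hC x hx
  have hC2 := hC (x + h) (by linarith)
  have hC3 : C * (x + h) ^ 2 ≤ C * (4 * x ^ 2) :=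
    mul_le_mul_of_nonneg_left (by nlinarith) hC0
  rw [add_sub_cancel_left] at hkey
  rw [← abs_of_nonneg hh, ← abs_mul, abs_of_nonneg hh]
  rw [abs_le] at *
  constructor <;> linarith [hE.1, hE.2, hC1.1, hC1.2, hC2.1, hC2.2]

lemma exists_abs_sum_logWeighted_le (N : ℕ) : ∃ C, 0 ≤ C ∧ ∀ x : ℝ, 2 ≤ x →
    |∑ n ∈ Finset.Icc 0 ⌊x⌋₊, logWeighted (2 * N + 1) n| ≤ C * (x * log x ^ (N + 1)) := by
  obtain ⟨C, hC0, hC⟩ := exists_abs_riesz_mean_logWeighted_le (2 * N + 1)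
  set D : ℝ := 5 * C + (1 + (N + 1).factorial) * (2 ^ (2 * N + 1) * 3) with hD
  have hD0 : 0 ≤ D := by positivity
  have hlarge : ∀ x : ℝ, 3 ≤ x →
      |∑ n ∈ Finset.Icc 0 ⌊x⌋₊, logWeighted (2 * N + 1) n| ≤ D * (x * log x ^ (N + 1)) := by
    intro x hx
    set L := log x with hL
    have hL1 : 1 ≤ L := by
      rw [hL, le_log_iff_exp_le (by linarith)]
      linarith [exp_one_lt_d9]
    have hP : 0 < L ^ (N + 1) := by positivity
    have hP1 : 1 ≤ L ^ (N + 1) := one_le_pow₀ hL1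
    have hx0 : 0 < x := by linarith
    set h := x / L ^ (N + 1) with hh
    have hh0 : 0 < h := by positivity
    have hhx : h ≤ x := div_le_self hx0.le hP1
    have hhP : h * L ^ (N + 1) = x := div_mul_cancel₀ _ hP.ne'
    have hfac : 1 ≤ (N + 1).factorial * h := by
      have h1 := pow_div_factorial_le_exp (x := L) (by linarith) (N + 1)
      rw [hL, exp_log hx0, ← hL, div_le_iff₀ (by positivity), mul_comm] at h1
      rw [hh, ← mul_div_assoc, le_div_iff₀ hP]
      linarith
    have hmain := mul_abs_sum_logWeighted_le (2 * N + 1) hx hh0.le hhx hC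
    have hw : (2 * L) ^ (2 * N + 1) * (1 + 2 * L) ≤
        2 ^ (2 * N + 1) * 3 * (L ^ (N + 1) * L ^ (N + 1)) := by
      calc (2 * L) ^ (2 * N + 1) * (1 + 2 * L) ≤ (2 * L) ^ (2 * N + 1) * (3 * L) := by
            gcongr; linarith
        _ = _ := by ring
    have hh1 : h + 1 ≤ (1 + (N + 1).factorial) * h := by linarith
    have hb : (h + 1) * ((2 * L) ^ (2 * N + 1) * (1 + 2 * L)) ≤
        (1 + (N + 1).factorial) * h *
          (2 ^ (2 * N + 1) * 3 * (L ^ (N + 1) * L ^ (N + 1))) := by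
      gcongr
    refine le_of_mul_le_mul_left (hmain.trans ?_) hh0
    calc _ ≤ 5 * C * x ^ 2 + h * ((1 + (N + 1).factorial) * h *
          (2 ^ (2 * N + 1) * 3 * (L ^ (N + 1) * L ^ (N + 1)))) := by gcongr
      _ = h * (D * (x * L ^ (N + 1))) := by
        rw [hD, ← hhP]
        ring
  have hl2 : 0 < log 2 := log_pos (by norm_num)
  set s := |∑ n ∈ Finset.Icc 0 2, logWeighted (2 * N + 1) n|
  refine ⟨D + s / (2 * log 2 ^ (N + 1)), by positivity, fun x hx => ?_⟩
  have hlx : log 2 ≤ log x := log_le_log (by norm_num) hx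
  have hlx0 : 0 < log x := hl2.trans_le hlx
  rw [add_mul]
  rcases le_or_gt 3 x with h3 | h3
  · exact (hlarge x h3).trans (le_add_of_nonneg_right (by positivity))
  · have hfl : ⌊x⌋₊ = 2 := by
      rw [Nat.floor_eq_iff (by linarith)]
      norm_num
      exact ⟨hx, h3⟩
    rw [hfl]
    refine le_add_of_nonneg_of_le (by positivity) ?_
    rw [div_mul_eq_mul_div, le_div_iff₀ (by positivity)]
    gcongr

lemma sum_inv_log_pow_mul_logWeighted (k : ℕ) (hk : k ≠ 0) {M : ℕ} (hM : 1 ≤ M) :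
    ∑ n ∈ Finset.Icc 0 M, 1 / log (n : ℝ) ^ k * logWeighted k n =
      M - 1 - ∑ n ∈ Finset.Ioc 0 M, ArithmeticFunction.vonMangoldt n := by
  induction M, hM using Nat.le_induction with
  | base => simp [Finset.sum_Icc_succ_top, logWeighted, hk]
  | succ M hM ih =>
    have h1 : (1 : ℝ) < (M + 1 : ℕ) := by exact_mod_cast Nat.lt_succ_of_le hM
    have hl : log ((M + 1 : ℕ) : ℝ) ^ k ≠ 0 := pow_ne_zero _ (log_pos h1).ne'
    rw [Finset.sum_Icc_succ_top (by omega), Finset.sum_Ioc_succ_top (by omega), ih, logWeighted,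
      if_neg (by omega), ← mul_assoc, one_div, inv_mul_cancel₀ hl]
    push_cast
    ring

lemma hasDerivAt_inv_log_pow (k : ℕ) {t : ℝ} (ht : 1 < t) :
    HasDerivAt (fun t => 1 / log t ^ k) (-k / (t * log t ^ (k + 1))) t := by
  have hl := (log_pos ht).ne'
  have ht0 : t ≠ 0 := by linarith
  have h := ((hasDerivAt_log ht0).pow k).inv (pow_ne_zero k hl)
  simp only [one_div]
  refine h.congr_deriv ?_
  rcases k with _ | k
  · simp
  · simp only [Pi.pow_apply, Nat.add_sub_cancel]
    field_simp
    ring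

theorem psi_sub_self_isBigO (N : ℕ) :
    (fun x : ℝ => Chebyshev.psi x - x) =O[atTop] fun x => x / log x ^ N := by
  obtain ⟨C, hC0, hC⟩ := exists_abs_sum_logWeighted_le N
  set k := 2 * N + 1 with hk
  have hbig : (fun x : ℝ => C * (x / log x ^ N) + (k * C) * ∫ t in (2 : ℝ)..x, 1 / log t ^ (N + 1))
      =O[atTop] fun x => x / log x ^ N := by
    refine ((isBigO_refl _ _).const_mul_left _).add (((integral_inv_log_pow_isBigO (N + 1)).trans
      ?_).const_mul_left _)
    refine IsBigO.of_bound 1 ?_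
    filter_upwards [eventually_ge_atTop 3] with x hx
    have hL1 : 1 ≤ log x := by
      rw [le_log_iff_exp_le (by linarith)]
      linarith [exp_one_lt_d9]
    rw [norm_of_nonneg (by positivity), norm_of_nonneg (by positivity), one_mul]
    gcongr
    omega
  refine IsBigO.trans (IsBigO.of_bound 1 ?_) (hbig.add (const_isBigO_div_log_pow 2 N))
  filter_upwards [eventually_ge_atTop 2] with x hx
  have hl : ∀ t : ℝ, 2 ≤ t → 0 < log t := fun t ht => log_pos (by linarith)
  have hlx := hl x hx
  have hderiv : ∀ t : ℝ, 2 ≤ t →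
      deriv (fun t : ℝ => 1 / log t ^ k) t = -k / (t * log t ^ (k + 1)) :=
    fun t ht => (hasDerivAt_inv_log_pow k (by linarith)).deriv
  have habel := sum_mul_eq_sub_integral_mul₁ (f := fun t : ℝ => 1 / log t ^ k) (logWeighted k)
    (by simp [logWeighted]) (by simp [logWeighted, hk]) x
    (fun t ht => (hasDerivAt_inv_log_pow k (by linarith [ht.1])).differentiableAt) ?_
  · rw [sum_inv_log_pow_mul_logWeighted k (by omega) (Nat.le_floor (by norm_num; linarith))]
      at habel
    have hint : |∫ t in Set.Ioc 2 x, deriv (fun t : ℝ => 1 / log t ^ k) t *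
        ∑ n ∈ Finset.Icc 0 ⌊t⌋₊, logWeighted k n| ≤
        (k * C) * ∫ t in (2 : ℝ)..x, 1 / log t ^ (N + 1) := by
      rw [← intervalIntegral.integral_of_le hx, ← intervalIntegral.integral_const_mul,
        ← Real.norm_eq_abs]
      refine intervalIntegral.norm_integral_le_of_norm_le hx (ae_of_all _ fun t ht => ?_)
        ((intervalIntegrable_inv_log_pow (N + 1) (by norm_num) (by linarith)).const_mul _)
      have ht2 : 2 ≤ t := ht.1.le
      have hlt := hl t ht2
      have ht0 : 0 < t := by linarith
      rw [hderiv t ht2, norm_mul, Real.norm_eq_abs, Real.norm_eq_abs, neg_div, abs_neg,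
        abs_of_nonneg (by positivity)]
      calc _ ≤ k / (t * log t ^ (k + 1)) * (C * (t * log t ^ (N + 1))) := by
            gcongr
            exact hC t ht2
        _ = _ := by
          rw [hk]
          field_simp
          ring
    have hmain : |1 / log x ^ k * ∑ n ∈ Finset.Icc 0 ⌊x⌋₊, logWeighted k n| ≤
        C * (x / log x ^ N) := by
      rw [abs_mul, abs_of_nonneg (by positivity)]
      calc _ ≤ 1 / log x ^ k * (C * (x * log x ^ (N + 1))) := by
            gcongr
            exact hC x hx
        _ = _ := by
          rw [hk]
          field_simp
          ring
    have h1 : (⌊x⌋₊ : ℝ) ≤ x := Nat.floor_le (by linarith)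
    have h2 : x < ⌊x⌋₊ + 1 := Nat.lt_floor_add_one x
    rw [one_mul, Real.norm_eq_abs]
    refine le_trans ?_ (le_abs_self _)
    rw [Chebyshev.psi]
    rw [abs_le] at *
    constructor <;> linarith [hint.1, hint.2, hmain.1, hmain.2]
  · refine ContinuousOn.integrableOn_Icc (ContinuousOn.congr (f := fun t : ℝ =>
      -k / (t * log t ^ (k + 1))) (fun t ht => ContinuousAt.continuousWithinAt ?_)
      fun t ht => hderiv t ht.1)
    have ht0 : t ≠ 0 := by linarith [ht.1]
    have hlt : t * log t ^ (k + 1) ≠ 0 := mul_ne_zero ht0 (pow_ne_zero _ (hl t ht.1).ne')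
    fun_prop (disch := assumption)

theorem theta_sub_self_isBigO (N : ℕ) :
    (fun x : ℝ => Chebyshev.theta x - x) =O[atTop] fun x => x / log x ^ N := by
  obtain ⟨C, hC⟩ := Chebyshev.psi_sub_theta_le_mul_sqrt
  have h : (fun x : ℝ => Chebyshev.psi x - Chebyshev.theta x) =O[atTop]
      fun x => x / log x ^ N := by
    refine IsBigO.trans (IsBigO.of_bound C (Eventually.of_forall fun x => ?_))
      (sqrt_isBigO_div_log_pow N)
    rw [Real.norm_of_nonneg (sub_nonneg.2 (Chebyshev.theta_le_psi x)),
      Real.norm_of_nonneg (sqrt_nonneg x)]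
    exact hC x
  exact ((psi_sub_self_isBigO N).sub h).congr_left fun x => by ring

/-- The prime number theorem with an error term saving an arbitrary power of the logarithm. -/
theorem exists_abs_theta_sub_self_le (N : ℕ) : ∃ C, ∀ x : ℝ, 2 ≤ x →
    |Chebyshev.theta x - x| ≤ C * (x / log x ^ N) := by
  obtain ⟨C, hC0, hC⟩ := (theta_sub_self_isBigO N).exists_pos
  obtain ⟨T, hT⟩ := eventually_atTop.1 hC.bound
  have hlog4 : 0 ≤ log 4 := log_nonneg (by norm_num)
  refine ⟨C + (log 4 + 1) * |log T| ^ N, fun x hx => ?_⟩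
  have hlx : 0 < log x := log_pos (by linarith)
  rw [add_mul]
  rcases le_total T x with h | h
  · have h1 := hT x h
    rw [Real.norm_eq_abs, Real.norm_of_nonneg (by positivity)] at h1
    exact h1.trans (le_add_of_nonneg_right (by positivity))
  · refine le_add_of_nonneg_of_le (by positivity) ?_
    have h1 : |Chebyshev.theta x - x| ≤ (log 4 + 1) * x := by
      have h2 := Chebyshev.theta_le_log4_mul_x (by linarith : 0 ≤ x)
      have h3 := Chebyshev.theta_nonneg x
      have h4 : 0 ≤ log 4 * x := by positivity
      rw [abs_le]
      constructor <;> linarith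
    refine h1.trans ?_
    rw [mul_assoc, ← mul_div_assoc]
    gcongr
    rw [le_div_iff₀ (by positivity), mul_comm]
    gcongr
    exact (log_le_log (by linarith) h).trans (le_abs_self _)

end Unsmoothing

/-- Fix `n ≥ 1`, and let `w_k(y)` be the `k`-th approximant of the continued fraction with
partial numerators `a₁ = 1`, `a_j = ((j−1)n)²` for `j ≥ 2`, and partial denominators
`b_j = y − (2j−1)n`.  Then for every `k ≥ 0`,
`e^{−y/n}·∑_{m=n}^∞ (1/m)·π(e^{y/m}) − w_k(y) ∼ (n^k·k!)²/y^{2k+1}` as `y → ∞`. -/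
theorem riemannPi_tail_cf_approximant_asymptotics (n : ℕ) (hn : 1 ≤ n) (k : ℕ) :
    Tendsto (fun y : ℝ =>
        (Real.exp (-(y / n)) *
            (∑' j : ℕ, (1 / ((j : ℝ) + n)) * primePi (Real.exp (y / ((j : ℝ) + n))))
          - cfApprox (fun j => if j = 1 then 1 else (((j - 1) * n : ℕ) : ℝ) ^ 2)
              (fun j => y - ((2 * j - 1 : ℕ) : ℝ) * n) 1 k)
        / (((n : ℝ) ^ k * (Nat.factorial k : ℝ)) ^ 2 / y ^ (2 * k + 1)))
      atTop (nhds 1) := by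
  have hn0 : (0 : ℝ) < n := by exact_mod_cast hn
  have hC : 0 < ((n : ℝ) ^ k * (Nat.factorial k : ℝ)) ^ 2 := by positivity
  have hE := hasInvExpansion_riemannPi_tail hn
    (primeCounting_sub_sum_isBigO exists_abs_theta_sub_self_le)
  have key := tendsto_sub_cfApprox hn0
    (a := fun j => if j = 1 then 1 else (((j - 1) * n : ℕ) : ℝ) ^ 2)
    (b := fun j y => y - ((2 * j - 1 : ℕ) : ℝ) * n) (by simp) (by intro k; simp)
    (by intro k y; rw [show 2 * (k + 1) - 1 = 2 * k + 1 by omega]; push_cast; ring) hE k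
  have key' := key.div_const (((n : ℝ) ^ k * (Nat.factorial k : ℝ)) ^ 2)
  rw [div_self hC.ne'] at key'
  refine key'.congr fun y => ?_
  rw [div_div_eq_mul_div]
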